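/- arXiv:2006.07947 — 2 statements merged into one kernel-verified Lean document; each statement's English description precedes it below -/
import Mathlib

section
/- Let W be a 2-dimensional Coxeter group. Let f ∈ W with T(f) = {s, t} for distinct s, t ∈ S (so that m_st < ∞), let h = Π(f), and let R = f⟨s,t⟩ be the {s,t}-residue containing f and h. Let g ∈ R, let m = ℓ(h⁻¹g), and suppose T(g) = {s, r} for some r ∈ S with r ∉ {s, t}. If m = 3, then m_sr = 2. -/
namespace CoxeterPaper

open CoxeterSystem

attribute [local instance] Classical.propDecidable

variable {B : Type} [DecidableEq B] [Fintype B]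
variable {W : Type} [Group W] {M : CoxeterMatrix B}

/-- The right descent set `T(g) = {s ∈ S : ℓ(gs) < ℓ(g)}`, as a set of indices. -/
def descentSet (cs : CoxeterSystem M W) (g : W) : Set B :=
  {i | cs.IsRightDescent g i}

/-- The subgroup `⟨T(g)⟩` generated by the right descent set of `g`. -/
def descSubgroup (cs : CoxeterSystem M W) (g : W) : Subgroup W :=
  Subgroup.closure (cs.simple '' descentSet cs g)

/-- `w(g)`: the longest element of `⟨T(g)⟩` (defined via choice; for `g ≠ 1` the
subgroup `⟨T(g)⟩` is finite and has a unique longest element). -/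
noncomputable def wg (cs : CoxeterSystem M W) (g : W) : W :=
  if h : ∃ w₀ ∈ descSubgroup cs g, ∀ u ∈ descSubgroup cs g, cs.length u ≤ cs.length w₀
  then h.choose else 1

/-- `Π(g) = g · w(g)`. -/
noncomputable def PiMap (cs : CoxeterSystem M W) (g : W) : W := g * wg cs g

/-- The standard language `𝓛 ⊆ S*`: the empty word is in `𝓛` (and it is the only word of `𝓛`
representing the identity); a word `v` of length `n` representing `g ≠ 1` is in `𝓛` iff,
setting `k = ℓ(w(g))`, the prefix `v(n-k)` is in `𝓛` and `v(n-k+1, n)` represents `w(g)`. -/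
inductive StdLang (cs : CoxeterSystem M W) : List B → Prop
  | nil : StdLang cs []
  | step (v : List B) (hne : cs.wordProd v ≠ 1)
      (hpre : StdLang cs (v.take (v.length - cs.length (wg cs (cs.wordProd v)))))
      (hsuf : cs.wordProd (v.drop (v.length - cs.length (wg cs (cs.wordProd v))))
        = wg cs (cs.wordProd v)) : StdLang cs v

/-- A Coxeter group is 2-dimensional if every triple of distinct generators
generates an infinite subgroup. -/
def TwoDimensional (cs : CoxeterSystem M W) : Prop :=
  ∀ i j k : B, i ≠ j → i ≠ k → j ≠ k →
    Infinite (Subgroup.closure {cs.simple i, cs.simple j, cs.simple k} : Subgroup W)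

/-- The wall of the reflection `ρ` separates `g` and `h`. -/
def Separates (cs : CoxeterSystem M W) (ρ g h : W) : Prop :=
  Xor' (cs.length (ρ * g) < cs.length g) (cs.length (ρ * h) < cs.length h)

/-- `h` is adjacent to the wall of the reflection `ρ`. -/
def AdjacentWall (cs : CoxeterSystem M W) (ρ h : W) : Prop :=
  ∃ i : B, ρ = h * cs.simple i * h⁻¹

/-- The wall of `ρ'` separates `g` from the wall of `ρ`. -/
def SeparatesFromWall (cs : CoxeterSystem M W) (ρ' g ρ : W) : Prop :=
  ∀ h : W, AdjacentWall cs ρ h → Separates cs ρ' g h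

/-- `𝓦(g)`: the set of walls (identified with their reflections) separating `g` from the
identity and not separated from `g` by any other wall. -/
def WallsNear (cs : CoxeterSystem M W) (g : W) : Set W :=
  {ρ | cs.IsReflection ρ ∧ cs.length (ρ * g) < cs.length g ∧
    ∀ ρ' : W, cs.IsReflection ρ' → ρ' ≠ ρ → ¬ SeparatesFromWall cs ρ' g ρ}

set_option linter.unusedSectionVars false

/-- The linear form `2 · B(eᵢ, ·)` of the geometric representation of a Coxeter matrix. -/
noncomputable def geomForm (M : CoxeterMatrix B) (i : B) : Module.Dual ℝ (B →₀ ℝ) :=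
  Finsupp.linearCombination ℝ fun j => -2 * Real.cos (Real.pi / M i j)

theorem geomForm_single (M : CoxeterMatrix B) (i j : B) (a : ℝ) :
    geomForm M i (Finsupp.single j a) = a * (-2 * Real.cos (Real.pi / M i j)) := by
  simp [geomForm]

theorem geomForm_single_self (M : CoxeterMatrix B) (i : B) :
    geomForm M i (Finsupp.single i 1) = 2 := by
  simp [geomForm_single]

/-- The simple reflections of the geometric representation of a Coxeter matrix. -/
noncomputable def geomReflection (M : CoxeterMatrix B) (i : B) : (B →₀ ℝ) ≃ₗ[ℝ] (B →₀ ℝ) :=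
  Module.reflection (geomForm_single_self M i)

theorem isLiftable_geomReflection (M : CoxeterMatrix B) : M.IsLiftable (geomReflection M) := by
  intro i j
  unfold geomReflection
  rcases eq_or_ne i j with rfl | hij
  · rw [M.diagonal, pow_one]
    exact mul_eq_one_iff_eq_inv.mpr (Module.reflection_inv _).symm
  ext1 z
  set n := M i j with hn
  have hn1 : n ≠ 1 := M.off_diagonal i j hij
  set c := Real.cos (Real.pi / n) with hc
  have h1 : geomForm M i (Finsupp.single j 1) = -2 * c := by
    rw [geomForm_single, one_mul]
  have h2 : geomForm M j (Finsupp.single i 1) = -2 * c := by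
    rw [geomForm_single, one_mul, M.symmetric j i]
  obtain hn0 | hn2 | hn3 : n = 0 ∨ n = 2 ∨ 3 ≤ n := by lia
  · simp [hn0]
  · have hc0 : c = 0 := by simp [hc, hn2]
    rw [Module.reflection_mul_reflection_pow_apply, h1, h2, hc0, hn2]
    norm_num [Polynomial.Chebyshev.S_neg_one]
    module
  set θ := 2 * Real.pi / n with hθ
  have hnpos : (0 : ℝ) < n := by positivity
  have hnθ : n * θ = 2 * Real.pi := by rw [hθ]; field_simp
  have hsin : Real.sin θ ≠ 0 := by
    refine (Real.sin_pos_of_pos_of_lt_pi (by positivity) ?_).ne'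
    rw [hθ, div_lt_iff₀ hnpos]
    have : (3 : ℝ) ≤ n := by exact_mod_cast hn3
    nlinarith [Real.pi_pos]
  have ht : 2 * Real.cos θ =
      geomForm M i (Finsupp.single j 1) * geomForm M j (Finsupp.single i 1) - 2 := by
    rw [h1, h2, hθ, mul_div_assoc, Real.cos_two_mul]
    ring
  rw [Module.reflection_mul_reflection_pow_apply _ _ _ _ _ ht]
  obtain ⟨k, hk | hk⟩ := Nat.even_or_odd' n
  · have e1 : ((n : ℤ) - 2) / 2 = k - 1 := by lia
    have e2 : ((n : ℤ) - 1) / 2 = k - 1 := by lia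
    have hS : (Polynomial.Chebyshev.S ℝ (k - 1 : ℤ)).eval (2 * Real.cos θ) = 0 := by
      refine (mul_eq_zero.mp ?_).resolve_right hsin
      rw [Polynomial.Chebyshev.S_two_mul_real_cos]
      have : ((((k : ℤ) - 1 : ℤ) : ℝ) + 1) * θ = Real.pi := by
        have : (n : ℝ) = 2 * k := by exact_mod_cast hk
        rw [this] at hnθ
        push_cast
        linarith
      rw [this, Real.sin_pi]
    simp [e1, e2, hS]
  · have e1 : ((n : ℤ) - 2) / 2 = k - 1 := by lia
    have e2 : ((n : ℤ) - 1) / 2 = k := by lia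
    have e3 : ((n : ℤ) - 3) / 2 = k - 1 := by lia
    have e4 : (n : ℤ) / 2 = k := by lia
    have hS : (Polynomial.Chebyshev.S ℝ (k : ℤ)).eval (2 * Real.cos θ) +
        (Polynomial.Chebyshev.S ℝ (k - 1 : ℤ)).eval (2 * Real.cos θ) = 0 := by
      refine (mul_eq_zero.mp ?_).resolve_right hsin
      rw [add_mul, Polynomial.Chebyshev.S_two_mul_real_cos,
        Polynomial.Chebyshev.S_two_mul_real_cos]
      have : (((k : ℤ) : ℝ) + 1) * θ = 2 * Real.pi - ((((k : ℤ) - 1 : ℤ) : ℝ) + 1) * θ := by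
        have : (n : ℝ) = 2 * k + 1 := by exact_mod_cast hk
        rw [this] at hnθ
        push_cast
        linarith
      rw [this, Real.sin_two_pi_sub]
      ring
    simp [e1, e2, e3, e4, hS]

/-- The geometric representation of a Coxeter group. -/
noncomputable def geomRep (cs : CoxeterSystem M W) : W →* ((B →₀ ℝ) ≃ₗ[ℝ] (B →₀ ℝ)) :=
  cs.lift ⟨geomReflection M, isLiftable_geomReflection M⟩

theorem geomRep_simple_apply (cs : CoxeterSystem M W) (i : B) (v : B →₀ ℝ) :
    geomRep cs (cs.simple i) v = v - geomForm M i v • Finsupp.single i 1 := by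
  rw [geomRep, cs.lift_apply_simple, geomReflection, Module.reflection_apply]

theorem simple_injective (cs : CoxeterSystem M W) : Function.Injective cs.simple := by
  intro i j h
  by_contra hij
  have := congrArg (fun w => geomRep cs w (Finsupp.single i 1) i) h
  simp only [geomRep_simple_apply, geomForm_single_self] at this
  simp [hij] at this

theorem eq_two_of_commute (cs : CoxeterSystem M W) {i j : B} (hij : i ≠ j)
    (h : cs.simple i * cs.simple j = cs.simple j * cs.simple i) : M.M i j = 2 := by
  have := congrArg (fun w => geomRep cs w (Finsupp.single j 1) i) h
  have hc : Real.cos (Real.pi / M i j) = 0 := by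
    simp [geomRep_simple_apply, geomForm_single, hij] at this
    linarith
  change M i j = 2
  have hn1 : M i j ≠ 1 := M.off_diagonal i j hij
  obtain hn0 | hn2 | hn3 : M i j = 0 ∨ M i j = 2 ∨ 3 ≤ M i j := by lia
  · simp [hn0] at hc
  · exact hn2
  · refine absurd hc (Real.cos_pos_of_mem_Ioo ⟨?_, ?_⟩).ne'
    · have : 0 < Real.pi / M i j := by positivity
      linarith [Real.pi_pos]
    · have : (3 : ℝ) ≤ M i j := by exact_mod_cast hn3
      rw [div_lt_iff₀ (by linarith)]
      nlinarith [Real.pi_pos]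

/-- The action of a simple reflection on signed reflections. -/
noncomputable def signedConj (cs : CoxeterSystem M W) (i : B) : Equiv.Perm (W × ZMod 2) :=
  Function.Involutive.toPerm
    (fun p => (cs.simple i * p.1 * cs.simple i, p.2 + if p.1 = cs.simple i then 1 else 0)) <| by
      rintro ⟨t, ε⟩
      have : cs.simple i * t * cs.simple i = cs.simple i ↔ t = cs.simple i := by
        rw [mul_eq_right, ← cs.inv_simple i, inv_mul_eq_one, eq_comm, cs.inv_simple]
      simp only [this]
      simp [mul_assoc, add_assoc, CharTwo.add_self_eq_zero]

theorem signedConj_apply (cs : CoxeterSystem M W) (i : B) (t : W) (ε : ZMod 2) :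
    signedConj cs i (t, ε) =
      (cs.simple i * t * cs.simple i, ε + if t = cs.simple i then 1 else 0) :=
  rfl

theorem inv_pow_mul_simple (cs : CoxeterSystem M W) (i j : B) (k : ℕ) :
    ((cs.simple i * cs.simple j) ^ k)⁻¹ * cs.simple j =
      cs.simple j * (cs.simple i * cs.simple j) ^ k := by
  induction k with
  | zero => simp
  | succ k ih =>
    rw [pow_succ, mul_inv_rev, mul_assoc, ih, pow_mul_comm', ← mul_assoc, ← mul_assoc]
    simp [mul_assoc]

theorem signedConj_mul_pow (cs : CoxeterSystem M W) (i j : B) (n : ℕ) (t : W) (ε : ZMod 2) :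
    ((signedConj cs i * signedConj cs j) ^ n) (t, ε) =
      ((cs.simple i * cs.simple j) ^ n * t * ((cs.simple i * cs.simple j) ^ n)⁻¹,
        ε + ∑ k ∈ Finset.range (2 * n),
          if t = ((cs.simple i * cs.simple j) ^ k)⁻¹ * cs.simple j then 1 else 0) := by
  have hj := inv_pow_mul_simple cs i j
  set a := cs.simple i * cs.simple j with ha
  induction n with
  | zero => simp
  | succ n ih =>
    have h1 : a ^ n * t * (a ^ n)⁻¹ = cs.simple j ↔ t = (a ^ (2 * n))⁻¹ * cs.simple j := by
      rw [mul_inv_eq_iff_eq_mul, ← hj, ← eq_inv_mul_iff_mul_eq, two_mul, pow_add, mul_inv_rev,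
        mul_assoc]
    have h2 : cs.simple j * (a ^ n * t * (a ^ n)⁻¹) * cs.simple j = cs.simple i ↔
        t = (a ^ (2 * n + 1))⁻¹ * cs.simple j := by
      have e : (cs.simple j)⁻¹ * (cs.simple i * (cs.simple j)⁻¹) = a⁻¹ * cs.simple j := by
        simp [ha, mul_assoc]
      rw [← eq_mul_inv_iff_mul_eq, ← eq_inv_mul_iff_mul_eq, e, mul_inv_eq_iff_eq_mul, mul_assoc,
        ← hj, ← eq_inv_mul_iff_mul_eq, show 2 * n + 1 = n + 1 + n by ring, pow_add, pow_succ]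
      simp only [mul_inv_rev, mul_assoc]
    rw [pow_succ', Equiv.Perm.mul_apply, ih, mul_add, mul_one, Finset.sum_range_succ,
      Finset.sum_range_succ, Equiv.Perm.mul_apply, signedConj_apply, signedConj_apply]
    simp only [h1, h2, add_assoc]
    simp [pow_succ', ha, mul_assoc]

theorem isLiftable_signedConj (cs : CoxeterSystem M W) : M.IsLiftable (signedConj cs) := by
  intro i j
  refine Equiv.ext fun ⟨t, ε⟩ => ?_
  have hM : (cs.simple i * cs.simple j) ^ M i j = 1 := cs.simple_mul_simple_pow i j
  rw [signedConj_mul_pow, hM, two_mul, Finset.sum_range_add]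
  simp [pow_add, hM, CharTwo.add_self_eq_zero]

/-- The action of a Coxeter group on signed reflections. -/
noncomputable def signedConjHom (cs : CoxeterSystem M W) : W →* Equiv.Perm (W × ZMod 2) :=
  cs.lift ⟨signedConj cs, isLiftable_signedConj cs⟩

/-- The parity of the number of occurrences of `t` in the right inversion sequence of a word
for `w`. -/
noncomputable def invParity (cs : CoxeterSystem M W) (w t : W) : ZMod 2 :=
  (signedConjHom cs w (t, 0)).2

theorem signedConjHom_wordProd (cs : CoxeterSystem M W) (ω : List B) (t : W) (ε : ZMod 2) :
    signedConjHom cs (cs.wordProd ω) (t, ε) =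
      (cs.wordProd ω * t * (cs.wordProd ω)⁻¹, ε + (cs.rightInvSeq ω).count t) := by
  induction ω with
  | nil => simp
  | cons i ω ih =>
    rw [cs.wordProd_cons, map_mul, Equiv.Perm.mul_apply, ih, signedConjHom,
      cs.lift_apply_simple, signedConj_apply, CoxeterSystem.rightInvSeq, List.count_cons]
    have : cs.wordProd ω * t * (cs.wordProd ω)⁻¹ = cs.simple i ↔
        (cs.wordProd ω)⁻¹ * cs.simple i * cs.wordProd ω = t := by
      rw [mul_inv_eq_iff_eq_mul, ← eq_inv_mul_iff_mul_eq, mul_assoc, eq_comm]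
    simp only [this]
    simp [mul_assoc, add_assoc]

theorem invParity_wordProd (cs : CoxeterSystem M W) (ω : List B) (t : W) :
    invParity cs (cs.wordProd ω) t = (cs.rightInvSeq ω).count t := by
  simp [invParity, signedConjHom_wordProd]

theorem signedConjHom_apply (cs : CoxeterSystem M W) (w t : W) (ε : ZMod 2) :
    signedConjHom cs w (t, ε) = (w * t * w⁻¹, ε + invParity cs w t) := by
  obtain ⟨ω, rfl⟩ := cs.wordProd_surjective w
  rw [invParity_wordProd, signedConjHom_wordProd]

theorem invParity_mul (cs : CoxeterSystem M W) (w u t : W) :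
    invParity cs (w * u) t = invParity cs u t + invParity cs w (u * t * u⁻¹) := by
  rw [invParity, map_mul, Equiv.Perm.mul_apply, signedConjHom_apply cs u, signedConjHom_apply cs w,
    zero_add]

theorem invParity_one (cs : CoxeterSystem M W) (t : W) : invParity cs 1 t = 0 := by
  simp [invParity]

theorem invParity_simple_self (cs : CoxeterSystem M W) (i : B) :
    invParity cs (cs.simple i) (cs.simple i) = 1 := by
  rw [← cs.wordProd_singleton, invParity_wordProd]
  simp [CoxeterSystem.rightInvSeq]

theorem invParity_self (cs : CoxeterSystem M W) {t : W} (ht : cs.IsReflection t) :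
    invParity cs t t = 1 := by
  obtain ⟨v, i, rfl⟩ := ht
  have h := invParity_one cs (v * cs.simple i * v⁻¹)
  rw [← mul_inv_cancel v, invParity_mul] at h
  rw [invParity_mul, invParity_mul]
  simp only [mul_assoc, inv_inv, inv_mul_cancel_left, inv_mul_cancel, mul_one,
    cs.simple_mul_simple_self, cs.inv_simple, invParity_simple_self] at h ⊢
  rw [add_left_comm, one_mul, h, add_zero]

theorem isRightInversion_iff_invParity (cs : CoxeterSystem M W) {t : W} (ht : cs.IsReflection t)
    (w : W) : cs.IsRightInversion w t ↔ invParity cs w t = 1 := by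
  have key (v : W) (hv : invParity cs v t = 1) : cs.IsRightInversion v t := by
    obtain ⟨ω, hω, rfl⟩ := cs.exists_isReduced v
    refine cs.isRightInversion_of_mem_rightInvSeq hω (List.count_pos_iff.mp ?_)
    rw [Nat.pos_iff_ne_zero]
    rintro h0
    simp [invParity_wordProd, h0] at hv
  refine ⟨fun h => ?_, key w⟩
  by_contra h1
  refine ht.isRightInversion_mul_left_iff.mp (key (w * t) ?_) h
  rw [invParity_mul, invParity_self cs ht, mul_inv_cancel_right]
  have : ∀ x : ZMod 2, x ≠ 1 → 1 + x = 1 := by decide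
  exact this _ h1

theorem isRightInversion_mul_iff (cs : CoxeterSystem M W) {t : W} (ht : cs.IsReflection t)
    (w u : W) : cs.IsRightInversion (w * u) t ↔
      Xor (cs.IsRightInversion u t) (cs.IsRightInversion w (u * t * u⁻¹)) := by
  rw [isRightInversion_iff_invParity cs ht, isRightInversion_iff_invParity cs ht,
    isRightInversion_iff_invParity cs (ht.conj u), invParity_mul]
  generalize invParity cs u t = x
  generalize invParity cs w (u * t * u⁻¹) = y
  revert x y
  unfold Xor
  decide

theorem simple_mul_pow_comm (cs : CoxeterSystem M W) (i j : B) (n : ℕ) :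
    (cs.simple j * cs.simple i) ^ n = ((cs.simple i * cs.simple j) ^ n)⁻¹ := by
  rw [← inv_pow, mul_inv_rev, cs.inv_simple, cs.inv_simple]

theorem orderOf_simple_mul_comm (cs : CoxeterSystem M W) (i j : B) :
    orderOf (cs.simple j * cs.simple i) = orderOf (cs.simple i * cs.simple j) := by
  rw [← orderOf_inv, mul_inv_rev, cs.inv_simple, cs.inv_simple]

/-- The element represented by the alternating word of length `n` in `i`, `j` that ends in `j`. -/
noncomputable abbrev altProd (cs : CoxeterSystem M W) (i j : B) (n : ℕ) : W :=
  cs.wordProd (alternatingWord i j n)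

theorem altProd_succ (cs : CoxeterSystem M W) (i j : B) (n : ℕ) :
    altProd cs i j (n + 1) = altProd cs j i n * cs.simple j := by
  rw [altProd, alternatingWord_succ, cs.wordProd_concat]

theorem altProd_succ_mul (cs : CoxeterSystem M W) (i j : B) (n : ℕ) :
    altProd cs i j (n + 1) * cs.simple j = altProd cs j i n := by
  rw [altProd_succ, cs.simple_mul_simple_cancel_right]

theorem altProd_eq_swap_iff (cs : CoxeterSystem M W) (i j : B) (n : ℕ) :
    altProd cs i j n = altProd cs j i n ↔ (cs.simple i * cs.simple j) ^ n = 1 := by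
  rw [altProd, altProd, cs.prod_alternatingWord_eq_mul_pow, cs.prod_alternatingWord_eq_mul_pow,
    simple_mul_pow_comm cs i j, eq_mul_inv_iff_mul_eq]
  obtain ⟨k, rfl | rfl⟩ := Nat.even_or_odd' n
  · have e : 2 * k / 2 = k := by lia
    rw [e]
    simp [two_mul, pow_add]
  · have e : (2 * k + 1) / 2 = k := by lia
    rw [e, if_neg (by simp), if_neg (by simp), ← mul_right_inj (cs.simple i),
      cs.simple_mul_simple_self, show 2 * k + 1 = k + k + 1 by ring, pow_succ', pow_add]
    simp only [mul_assoc]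

theorem not_isRightDescent_altProd (cs : CoxeterSystem M W) (i j : B) {n : ℕ}
    (hn : orderOf (cs.simple i * cs.simple j) = 0 ∨ n < orderOf (cs.simple i * cs.simple j)) :
    ¬ cs.IsRightDescent (altProd cs i j n) i := by
  rw [← cs.isRightInversion_simple_iff_isRightDescent,
    isRightInversion_iff_invParity cs (cs.isReflection_simple i), invParity_wordProd]
  suffices h : cs.simple i ∉ cs.rightInvSeq (alternatingWord i j n) by
    simp [List.count_eq_zero_of_not_mem h]
  induction n with
  | zero => simp [alternatingWord]
  | succ n ih =>
    rw [alternatingWord_succ', CoxeterSystem.rightInvSeq, List.mem_cons, not_or]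
    refine ⟨fun h => ?_, ih (by lia)⟩
    have h1 : altProd cs i j (n + 1) = altProd cs j i (n + 1) := by
      rw [altProd_succ cs j i, h, altProd, alternatingWord_succ', cs.wordProd_cons]
      simp only [altProd, mul_assoc, mul_inv_cancel_left]
    rw [altProd_eq_swap_iff] at h1
    have h2 := orderOf_pos_iff.mpr (isOfFinOrder_iff_pow_eq_one.mpr ⟨n + 1, by lia, h1⟩)
    have h3 := orderOf_le_of_pow_eq_one (by lia) h1
    lia

theorem isRightDescent_altProd (cs : CoxeterSystem M W) (i j : B) {n : ℕ} (hn0 : n ≠ 0)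
    (hn : orderOf (cs.simple i * cs.simple j) = 0 ∨ n ≤ orderOf (cs.simple i * cs.simple j)) :
    cs.IsRightDescent (altProd cs i j n) j := by
  obtain ⟨n, rfl⟩ := Nat.exists_eq_succ_of_ne_zero hn0
  rw [cs.isRightDescent_iff_not_isRightDescent_mul, Nat.succ_eq_add_one, altProd_succ_mul]
  apply not_isRightDescent_altProd
  rw [orderOf_simple_mul_comm]
  lia

theorem length_altProd (cs : CoxeterSystem M W) (i j : B) {n : ℕ}
    (hn : orderOf (cs.simple i * cs.simple j) = 0 ∨ n ≤ orderOf (cs.simple i * cs.simple j)) :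
    cs.length (altProd cs i j n) = n := by
  induction n generalizing i j with
  | zero => simp [altProd, alternatingWord]
  | succ n ih =>
    have h := cs.isRightDescent_iff.mp (isRightDescent_altProd cs i j n.succ_ne_zero hn)
    rw [altProd_succ_mul, ih j i (by rw [orderOf_simple_mul_comm]; lia)] at h
    exact h.symm

theorem altProd_mem (cs : CoxeterSystem M W) (i j : B) (n : ℕ) :
    altProd cs i j n ∈ Subgroup.closure {cs.simple i, cs.simple j} := by
  rw [altProd, cs.prod_alternatingWord_eq_mul_pow]
  have hi : cs.simple i ∈ Subgroup.closure {cs.simple i, cs.simple j} :=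
    Subgroup.subset_closure (by simp)
  have hj : cs.simple j ∈ Subgroup.closure {cs.simple i, cs.simple j} :=
    Subgroup.subset_closure (by simp)
  refine mul_mem ?_ (pow_mem (mul_mem hi hj) _)
  split_ifs
  exacts [one_mem _, hj]

theorem exists_eq_altProd (cs : CoxeterSystem M W) (i j : B) {u : W}
    (hu : u ∈ Subgroup.closure {cs.simple i, cs.simple j}) :
    ∃ n, (orderOf (cs.simple i * cs.simple j) = 0 ∨ n ≤ orderOf (cs.simple i * cs.simple j)) ∧
      (u = altProd cs i j n ∨ u = altProd cs j i n) := by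
  have step (p q : B) (n : ℕ) (hn : orderOf (cs.simple p * cs.simple q) = 0 ∨
      n ≤ orderOf (cs.simple p * cs.simple q)) :
      ∃ n', (orderOf (cs.simple p * cs.simple q) = 0 ∨
          n' ≤ orderOf (cs.simple p * cs.simple q)) ∧
        (altProd cs p q n * cs.simple p = altProd cs p q n' ∨
          altProd cs p q n * cs.simple p = altProd cs q p n') := by
    by_cases h : orderOf (cs.simple p * cs.simple q) = 0 ∨
      n < orderOf (cs.simple p * cs.simple q)
    · exact ⟨n + 1, by lia, .inr (altProd_succ cs q p n).symm⟩
    · obtain ⟨m, hm⟩ := Nat.exists_eq_succ_of_ne_zero (n := n) (by lia)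
      refine ⟨m, by lia, .inl ?_⟩
      rw [(altProd_eq_swap_iff cs p q n).mpr, hm, Nat.succ_eq_add_one, altProd_succ_mul]
      rw [show n = orderOf (cs.simple p * cs.simple q) by lia, pow_orderOf_eq_one]
  have step' (p q : B) (n : ℕ) (hn : orderOf (cs.simple p * cs.simple q) = 0 ∨
      n ≤ orderOf (cs.simple p * cs.simple q)) :
      ∃ n', (orderOf (cs.simple p * cs.simple q) = 0 ∨
          n' ≤ orderOf (cs.simple p * cs.simple q)) ∧
        (altProd cs p q n * cs.simple q = altProd cs p q n' ∨
          altProd cs p q n * cs.simple q = altProd cs q p n') := by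
    cases n with
    | zero =>
      have := step q p 0
      rw [orderOf_simple_mul_comm] at this
      simpa [altProd, alternatingWord, or_comm] using this (by lia)
    | succ n => exact ⟨n, by lia, .inr (altProd_succ_mul cs p q n)⟩
  have hgen (u c : W) (hc : c ∈ ({cs.simple i, cs.simple j} : Set W))
      (hu : ∃ n, (orderOf (cs.simple i * cs.simple j) = 0 ∨
        n ≤ orderOf (cs.simple i * cs.simple j)) ∧
        (u = altProd cs i j n ∨ u = altProd cs j i n)) :
      ∃ n, (orderOf (cs.simple i * cs.simple j) = 0 ∨
        n ≤ orderOf (cs.simple i * cs.simple j)) ∧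
        (u * c = altProd cs i j n ∨ u * c = altProd cs j i n) := by
    have e := orderOf_simple_mul_comm cs i j
    obtain ⟨n, hn, rfl | rfl⟩ := hu <;> obtain rfl | rfl := hc
    · exact step i j n hn
    · exact step' i j n hn
    · simpa [e, or_comm] using step' j i n (by rwa [e])
    · simpa [e, or_comm] using step j i n (by rwa [e])
  induction hu using Subgroup.closure_induction_right with
  | one => exact ⟨0, by simp, by simp [altProd, alternatingWord]⟩
  | mul_right x hx c hc ih => exact hgen x c hc ih
  | mul_inv_cancel x hx c hc ih =>
    have : c⁻¹ = c := by obtain rfl | rfl := hc <;> exact cs.inv_simple _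
    rw [this]
    exact hgen x c hc ih

theorem eq_altProd_of_le_length (cs : CoxeterSystem M W) (i j : B) {u : W}
    (ho : orderOf (cs.simple i * cs.simple j) ≠ 0)
    (hu : u ∈ Subgroup.closure {cs.simple i, cs.simple j})
    (hl : orderOf (cs.simple i * cs.simple j) ≤ cs.length u) :
    u = altProd cs i j (orderOf (cs.simple i * cs.simple j)) := by
  obtain ⟨n, hn, rfl | rfl⟩ := exists_eq_altProd cs i j hu
  · rw [length_altProd cs i j hn] at hl
    rw [show n = orderOf (cs.simple i * cs.simple j) by lia]
  · rw [length_altProd cs j i (by rwa [orderOf_simple_mul_comm])] at hl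
    rw [(altProd_eq_swap_iff cs i j _).mpr (pow_orderOf_eq_one _),
      show n = orderOf (cs.simple i * cs.simple j) by lia]

/-- `z` is a base point of its `{i, j}`-residue: inside the residue, descents in `{i, j}` are
computed in the dihedral subgroup. -/
def IsResidueBase (cs : CoxeterSystem M W) (i j : B) (z : W) : Prop :=
  ∀ v ∈ Subgroup.closure {cs.simple i, cs.simple j}, ∀ c, c = i ∨ c = j →
    (cs.IsRightDescent (z * v) c ↔ cs.IsRightDescent v c)

theorem exists_isResidueBase (cs : CoxeterSystem M W) (i j : B) (x : W) :
    ∃ z u, x = z * u ∧ u ∈ Subgroup.closure {cs.simple i, cs.simple j} ∧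
      IsResidueBase cs i j z := by
  set D := Subgroup.closure {cs.simple i, cs.simple j} with hD
  obtain ⟨v₀, hv₀⟩ : ∃ v₀ : D, ∀ v : D, cs.length (x * v₀) ≤ cs.length (x * v) :=
    ⟨_, fun v => Function.argmin_le (fun v : D => cs.length (x * v)) v⟩
  refine ⟨x * v₀, (v₀ : W)⁻¹, by simp, inv_mem v₀.2, fun v hv c hc => ?_⟩
  have hcD : cs.simple c ∈ D := Subgroup.subset_closure (by rcases hc with rfl | rfl <;> simp)
  rw [← cs.isRightInversion_simple_iff_isRightDescent,
    ← cs.isRightInversion_simple_iff_isRightDescent,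
    isRightInversion_mul_iff cs (cs.isReflection_simple c)]
  have : ¬ cs.IsRightInversion (x * v₀) (v * cs.simple c * v⁻¹) := by
    rintro ⟨-, h⟩
    have hmem : (v₀ : W) * (v * cs.simple c * v⁻¹) ∈ D :=
      mul_mem v₀.2 (mul_mem (mul_mem hv hcD) (inv_mem hv))
    have := hv₀ ⟨_, hmem⟩
    simp only [mul_assoc] at this h
    lia
  simp [Xor, this]

theorem exists_eq_mul_altProd (cs : CoxeterSystem M W) {i j : B} {x : W}
    (hi : cs.IsRightDescent x i) (hj : cs.IsRightDescent x j) :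
    orderOf (cs.simple i * cs.simple j) ≠ 0 ∧ ∃ z, IsResidueBase cs i j z ∧
      x = z * altProd cs i j (orderOf (cs.simple i * cs.simple j)) := by
  obtain ⟨z, u, rfl, hu, hz⟩ := exists_isResidueBase cs i j x
  rw [hz u hu _ (.inl rfl)] at hi
  rw [hz u hu _ (.inr rfl)] at hj
  have key : orderOf (cs.simple i * cs.simple j) ≠ 0 ∧
      orderOf (cs.simple i * cs.simple j) ≤ cs.length u := by
    obtain ⟨n, hn, rfl | rfl⟩ := exists_eq_altProd cs i j hu
    · rw [length_altProd cs i j hn]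
      by_contra h
      exact not_isRightDescent_altProd cs i j (by lia) hi
    · rw [← orderOf_simple_mul_comm] at hn ⊢
      rw [length_altProd cs j i hn]
      by_contra h
      exact not_isRightDescent_altProd cs j i (by lia) hj
  exact ⟨key.1, z, hz, by rw [← eq_altProd_of_le_length cs i j key.1 hu key.2]⟩

/-- Multiplying `x` on the right by `j`, `i`, `j`, … (`n` letters) descends at every step. -/
def AltDescent (cs : CoxeterSystem M W) : ℕ → B → B → W → Prop
  | 0, _, _, _ => True
  | n + 1, i, j, x => cs.IsRightDescent x j ∧ AltDescent cs n j i (x * cs.simple j)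

theorem AltDescent.mono {cs : CoxeterSystem M W} {i j : B} {x : W} {m n : ℕ} (hmn : m ≤ n)
    (h : AltDescent cs n i j x) : AltDescent cs m i j x := by
  induction m generalizing n i j x with
  | zero => trivial
  | succ m ih =>
    obtain ⟨n, rfl⟩ := Nat.exists_eq_add_of_lt hmn
    exact ⟨h.1, ih (by lia) h.2⟩

theorem IsResidueBase.symm {cs : CoxeterSystem M W} {i j : B} {z : W}
    (h : IsResidueBase cs i j z) : IsResidueBase cs j i z := by
  intro v hv c hc
  rw [Set.pair_comm] at hv
  exact h v hv c hc.symm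

theorem IsResidueBase.altDescent {cs : CoxeterSystem M W} {i j : B} {z : W} {n : ℕ}
    (hz : IsResidueBase cs i j z)
    (hn : orderOf (cs.simple i * cs.simple j) = 0 ∨ n ≤ orderOf (cs.simple i * cs.simple j)) :
    AltDescent cs n i j (z * altProd cs i j n) := by
  induction n generalizing i j with
  | zero => trivial
  | succ n ih =>
    refine ⟨?_, ?_⟩
    · rw [hz _ (altProd_mem cs i j _) _ (.inr rfl)]
      exact isRightDescent_altProd cs i j n.succ_ne_zero hn
    · rw [mul_assoc, altProd_succ_mul]
      exact ih hz.symm (by rw [orderOf_simple_mul_comm]; lia)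

theorem altDescent_of_isRightDescent (cs : CoxeterSystem M W) {i j : B} {x : W} {n : ℕ}
    (hi : cs.IsRightDescent x i) (hj : cs.IsRightDescent x j)
    (hn : n ≤ orderOf (cs.simple i * cs.simple j)) : AltDescent cs n i j x := by
  obtain ⟨-, z, hz, hx⟩ := exists_eq_mul_altProd cs hi hj
  exact (hx ▸ hz.altDescent (.inr le_rfl)).mono hn

theorem finite_closure_of_finite_quotient {G : Type*} [Group G] {H : Subgroup G}
    (hH : (H : Set G).Finite) {S : Set G} (hS : ∀ x ∈ S, x * x = 1) {X : Set (G ⧸ H)}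
    (hX : X.Finite) (h1 : ((1 : G) : G ⧸ H) ∈ X) (hSX : ∀ x ∈ S, ∀ p ∈ X, x • p ∈ X) :
    Finite (Subgroup.closure S) := by
  have hA : ((fun g : G => (g : G ⧸ H)) ⁻¹' X).Finite := by
    refine hX.preimage' fun p _ => ?_
    obtain ⟨g, rfl⟩ := QuotientGroup.mk_surjective p
    refine (hH.image (g * ·)).subset fun x hx => ?_
    exact ⟨g⁻¹ * x, QuotientGroup.eq.mp (Eq.symm hx), by simp⟩
  refine (hA.subset fun g hg => ?_ : ((Subgroup.closure S : Subgroup G) : Set G).Finite).to_subtype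
  induction hg using Subgroup.closure_induction_left with
  | one => exact h1
  | mul_left x hx y hy ih => exact hSX x hx _ ih
  | inv_mul_cancel x hx y hy ih =>
    rw [inv_eq_of_mul_eq_one_left (hS x hx)]
    exact hSX x hx _ ih

theorem finite_closure_of_braid_four {G : Type*} [Group G] {s t r : G} (hs : s * s = 1)
    (ht : t * t = 1) (hr : r * r = 1) (hrt : r * t = t * r) (hrs : r * s * r = s * r * s)
    (hst : s * t * s * t = t * s * t * s)
    (hfin : (Subgroup.closure {s, t} : Set G).Finite) :
    Finite (Subgroup.closure {s, t, r}) := by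
  set H := Subgroup.closure {s, t}
  have hs' (p : G ⧸ H) : s • s • p = p := by rw [smul_smul, hs, one_smul]
  have ht' (p : G ⧸ H) : t • t • p = p := by rw [smul_smul, ht, one_smul]
  have hr' (p : G ⧸ H) : r • r • p = p := by rw [smul_smul, hr, one_smul]
  have hrt' (p : G ⧸ H) : t • r • p = r • t • p := by simp only [smul_smul, hrt]
  have hrs' (p : G ⧸ H) : r • s • r • p = s • r • s • p := by
    simp only [smul_smul, ← mul_assoc, hrs]
  have hst' (p : G ⧸ H) : t • s • t • s • p = s • t • s • t • p := by
    simp only [smul_smul, ← mul_assoc, hst]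
  set p₀ : G ⧸ H := ((1 : G) : G ⧸ H)
  have s0 : s • p₀ = p₀ := QuotientGroup.eq.mpr (by
    simpa using inv_mem (Subgroup.subset_closure (by simp) : s ∈ H))
  have t0 : t • p₀ = p₀ := QuotientGroup.eq.mpr (by
    simpa using inv_mem (Subgroup.subset_closure (by simp) : t ∈ H))
  have t1 : t • r • p₀ = r • p₀ := by rw [hrt', t0]
  have r2 : r • s • r • p₀ = s • r • p₀ := by rw [hrs', s0]
  have r3 : r • t • s • r • p₀ = t • s • r • p₀ := by rw [← hrt', r2]
  have t4 : t • s • t • s • r • p₀ = s • t • s • r • p₀ := by rw [hst', t1]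
  have s5 : s • r • s • t • s • r • p₀ = r • s • t • s • r • p₀ := by rw [← hrs', r3]
  have t5 : t • r • s • t • s • r • p₀ = r • s • t • s • r • p₀ := by rw [hrt', t4]
  refine finite_closure_of_finite_quotient hfin (by simp [hs, ht, hr])
    (X := {p₀, r • p₀, s • r • p₀, t • s • r • p₀, s • t • s • r • p₀, r • s • t • s • r • p₀})
    (Set.toFinite _) (by simp [p₀]) ?_
  rintro x (rfl | rfl | rfl) p (rfl | rfl | rfl | rfl | rfl | rfl) <;>
    simp only [Set.mem_insert_iff, Set.mem_singleton_iff, s0, t0, t1, r2, r3, t4, s5, t5, hs', ht',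
      hr', true_or, or_true]

theorem finite_closure_of_braid_five {G : Type*} [Group G] {s t r : G} (hs : s * s = 1)
    (ht : t * t = 1) (hr : r * r = 1) (hrt : r * t = t * r) (hrs : r * s * r = s * r * s)
    (hst : s * t * s * t * s = t * s * t * s * t)
    (hfin : (Subgroup.closure {s, t} : Set G).Finite) :
    Finite (Subgroup.closure {s, t, r}) := by
  set H := Subgroup.closure {s, t}
  have hs' (p : G ⧸ H) : s • s • p = p := by rw [smul_smul, hs, one_smul]
  have ht' (p : G ⧸ H) : t • t • p = p := by rw [smul_smul, ht, one_smul]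
  have hr' (p : G ⧸ H) : r • r • p = p := by rw [smul_smul, hr, one_smul]
  have hrt' (p : G ⧸ H) : t • r • p = r • t • p := by simp only [smul_smul, hrt]
  have hrs' (p : G ⧸ H) : r • s • r • p = s • r • s • p := by
    simp only [smul_smul, ← mul_assoc, hrs]
  have hst' (p : G ⧸ H) : s • t • s • t • s • p = t • s • t • s • t • p := by
    simp only [smul_smul, ← mul_assoc, hst]
  set p₀ : G ⧸ H := ((1 : G) : G ⧸ H)
  have s0 : s • p₀ = p₀ := QuotientGroup.eq.mpr (by
    simpa using inv_mem (Subgroup.subset_closure (by simp) : s ∈ H))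
  have t0 : t • p₀ = p₀ := QuotientGroup.eq.mpr (by
    simpa using inv_mem (Subgroup.subset_closure (by simp) : t ∈ H))
  have t1 : t • r • p₀ = r • p₀ := by rw [hrt', t0]
  have r2 : r • s • r • p₀ = s • r • p₀ := by rw [hrs', s0]
  have r3 : r • t • s • r • p₀ = t • s • r • p₀ := by rw [← hrt', r2]
  obtain ⟨p₄, h4⟩ : ∃ p, p = s • t • s • r • p₀ := ⟨_, rfl⟩
  have s4 : s • p₄ = t • s • r • p₀ := by rw [h4, hs']
  have st4 : s • t • p₄ = t • p₄ := by rw [h4, hst', t1]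
  have sr4 : s • r • p₄ = r • p₄ := by rw [h4, ← hrs', r3]
  obtain ⟨p₆, h6⟩ : ∃ p, p = r • t • p₄ := ⟨_, rfl⟩
  have r6 : r • p₆ = t • p₄ := by rw [h6, hr']
  have tr4 : t • r • p₄ = p₆ := by rw [hrt', h6]
  have t6 : t • p₆ = r • p₄ := by rw [← tr4, ht']
  have r7 : r • s • p₆ = s • p₆ := by rw [h6, hrs', st4]
  have r8 : r • t • s • p₆ = t • s • p₆ := by rw [← hrt', r7]
  obtain ⟨p₉, h9⟩ : ∃ p, p = s • t • s • p₆ := ⟨_, rfl⟩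
  have s9 : s • p₉ = t • s • p₆ := by rw [h9, hs']
  have t9 : t • p₉ = p₉ := by rw [h9, ← tr4, ← hst', sr4]
  have s10 : s • r • p₉ = r • p₉ := by rw [h9, ← hrs', r8]
  have t10 : t • r • p₉ = r • p₉ := by rw [hrt', t9]
  refine finite_closure_of_finite_quotient hfin (by simp [hs, ht, hr])
    (X := {p₀, r • p₀, s • r • p₀, t • s • r • p₀, p₄, t • p₄, r • p₄, p₆, s • p₆, t • s • p₆,
      p₉, r • p₉}) (Set.toFinite _) (by simp [p₀]) ?_
  rintro x (rfl | rfl | rfl) p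
      (rfl | rfl | rfl | rfl | rfl | rfl | rfl | rfl | rfl | rfl | rfl | rfl) <;>
    simp only [Set.mem_insert_iff, Set.mem_singleton_iff, s0, t0, t1, r2, r3, ← h4, s4, st4, sr4,
      ← h6, r6, tr4, t6, r7, r8, ← h9, s9, t9, s10, t10, hs', ht', hr', true_or, or_true]

theorem finite_closure_pair (cs : CoxeterSystem M W) (i j : B)
    (ho : orderOf (cs.simple i * cs.simple j) ≠ 0) :
    (Subgroup.closure {cs.simple i, cs.simple j} : Set W).Finite := by
  refine (((Set.finite_Iic (orderOf (cs.simple i * cs.simple j))).image (altProd cs i j)).union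
    ((Set.finite_Iic (orderOf (cs.simple i * cs.simple j))).image (altProd cs j i))).subset
    fun u hu => ?_
  obtain ⟨n, hn, rfl | rfl⟩ := exists_eq_altProd cs i j hu
  · exact .inl ⟨n, hn.resolve_left ho, rfl⟩
  · exact .inr ⟨n, hn.resolve_left ho, rfl⟩

theorem finite_closure_triple (cs : CoxeterSystem M W) {s t r : B}
    (hsr : orderOf (cs.simple s * cs.simple r) = 3) (htr : orderOf (cs.simple t * cs.simple r) = 2)
    (hst : orderOf (cs.simple s * cs.simple t) = 4 ∨ orderOf (cs.simple s * cs.simple t) = 5) :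
    Finite (Subgroup.closure {cs.simple s, cs.simple t, cs.simple r}) := by
  have hs := cs.simple_mul_simple_self s
  have ht := cs.simple_mul_simple_self t
  have hr := cs.simple_mul_simple_self r
  have esr := (altProd_eq_swap_iff cs s r 3).mpr (hsr ▸ pow_orderOf_eq_one _)
  have etr := (altProd_eq_swap_iff cs t r 2).mpr (htr ▸ pow_orderOf_eq_one _)
  have hfin := finite_closure_pair cs s t (by lia)
  have est := (altProd_eq_swap_iff cs s t _).mpr (pow_orderOf_eq_one _)
  simp only [altProd, alternatingWord, wordProd_concat, wordProd_nil, one_mul] at esr etr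
  rcases hst with h | h <;> rw [h] at est <;>
    simp only [altProd, alternatingWord, wordProd_concat, wordProd_nil, one_mul] at est
  · exact finite_closure_of_braid_four hs ht hr etr.symm esr est hfin
  · exact finite_closure_of_braid_five hs ht hr etr.symm esr est.symm hfin

theorem false_of_isRightDescent_of_three_le (cs : CoxeterSystem M W) {p q o : B}
    (hpq : 3 ≤ orderOf (cs.simple p * cs.simple q)) (hqo : 3 ≤ orderOf (cs.simple q * cs.simple o))
    (hop : 3 ≤ orderOf (cs.simple o * cs.simple p)) {y : W} (yp : cs.IsRightDescent y p)
    (yq : cs.IsRightDescent y q) (yoo : cs.IsRightDescent (y * cs.simple o) o)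
    (yop : cs.IsRightDescent (y * cs.simple o) p) : False := by
  obtain ⟨-, ypq, -⟩ := altDescent_of_isRightDescent cs (n := 2) yq yp
    (by rw [orderOf_simple_mul_comm]; lia)
  obtain ⟨-, -, ypo, -⟩ := altDescent_of_isRightDescent cs (n := 3) yop yoo
    (by rwa [orderOf_simple_mul_comm])
  rw [cs.simple_mul_simple_cancel_right] at ypo
  exact false_of_isRightDescent_of_three_le cs hqo hop hpq ypq ypo
    (by rwa [cs.simple_mul_simple_cancel_right]) (by rwa [cs.simple_mul_simple_cancel_right])
termination_by cs.length y
decreasing_by exact yp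

theorem simple_mul_comm_of_orderOf_eq_two (cs : CoxeterSystem M W) {i j : B}
    (h : orderOf (cs.simple i * cs.simple j) = 2) :
    cs.simple i * cs.simple j = cs.simple j * cs.simple i := by
  have := (altProd_eq_swap_iff cs i j 2).mpr (h ▸ pow_orderOf_eq_one _)
  simpa only [altProd, alternatingWord, wordProd_concat, wordProd_nil, one_mul] using this

theorem false_of_isRightDescent_of_four_le (cs : CoxeterSystem M W) {s t r : B}
    (hsr : 4 ≤ orderOf (cs.simple s * cs.simple r)) (htr : orderOf (cs.simple t * cs.simple r) = 2)
    (hst : 4 ≤ orderOf (cs.simple s * cs.simple t)) {z : W}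
    (zts : cs.IsRightDescent (z * cs.simple t) s) (ztr : cs.IsRightDescent (z * cs.simple t) r)
    (zrs : cs.IsRightDescent (z * cs.simple r) s) (zrt : cs.IsRightDescent (z * cs.simple r) t) :
    False := by
  have hcomm : z * cs.simple r * cs.simple t = z * cs.simple t * cs.simple r := by
    rw [mul_assoc, ← simple_mul_comm_of_orderOf_eq_two cs htr, mul_assoc]
  obtain ⟨-, h1, h2, h3, -⟩ := altDescent_of_isRightDescent cs zts ztr hsr
  obtain ⟨-, -, h4, h5, -⟩ := altDescent_of_isRightDescent cs zrs zrt hst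
  rw [hcomm] at h4 h5
  obtain ⟨-, h6, -⟩ := altDescent_of_isRightDescent cs (n := 2) h2 h4
    (by rw [orderOf_simple_mul_comm, htr])
  obtain ⟨-, h7, -⟩ := altDescent_of_isRightDescent cs (n := 2) h4 h2 htr.ge
  have hlt := (h4.trans h1).trans ztr
  exact false_of_isRightDescent_of_four_le cs hsr htr hst h5 h6 h3 h7
termination_by cs.length (z * cs.simple t)
decreasing_by exact hlt

theorem isRightDescent_of_isRightDescent_pairs (cs : CoxeterSystem M W) {s t r : B}
    (hsr : 3 ≤ orderOf (cs.simple s * cs.simple r)) (htr : orderOf (cs.simple t * cs.simple r) = 2)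
    (hst : 4 ≤ orderOf (cs.simple s * cs.simple t)) {y : W}
    (ys : cs.IsRightDescent y s) (yr : cs.IsRightDescent y r)
    (ytt : cs.IsRightDescent (y * cs.simple t) t) (ytr : cs.IsRightDescent (y * cs.simple t) r)
    (ytss : cs.IsRightDescent (y * cs.simple t * cs.simple s) s)
    (ytsr : cs.IsRightDescent (y * cs.simple t * cs.simple s) r) :
    cs.IsRightDescent (y * cs.simple t * cs.simple r) s ∧
    cs.IsRightDescent (y * cs.simple t * cs.simple r) t ∧
    y * cs.simple t * cs.simple r * cs.simple t = y * cs.simple r ∧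
    cs.IsRightDescent (y * cs.simple r) s ∧
    cs.IsRightDescent (y * cs.simple r * cs.simple s) t ∧
    cs.IsRightDescent (y * cs.simple r * cs.simple s) r ∧
    cs.IsRightDescent (y * cs.simple r * cs.simple s * cs.simple t) s ∧
    cs.IsRightDescent (y * cs.simple r * cs.simple s * cs.simple t) r := by
  have hcomm : y * cs.simple t * cs.simple r * cs.simple t = y * cs.simple r := by
    rw [mul_assoc y, simple_mul_comm_of_orderOf_eq_two cs htr, ← mul_assoc,
      cs.simple_mul_simple_cancel_right]
  obtain ⟨-, -, h1, -⟩ := altDescent_of_isRightDescent cs (n := 3) ytsr ytss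
    (by rwa [orderOf_simple_mul_comm])
  rw [cs.simple_mul_simple_cancel_right] at h1
  obtain ⟨-, h2, -⟩ := altDescent_of_isRightDescent cs (n := 2) ytt ytr htr.ge
  obtain ⟨-, h3, h4, h5, -⟩ := altDescent_of_isRightDescent cs h1 h2 hst
  rw [hcomm] at h3 h4 h5
  obtain ⟨-, -, h6, -⟩ := altDescent_of_isRightDescent cs ys yr hsr
  obtain ⟨-, h7, -⟩ := altDescent_of_isRightDescent cs (n := 2) h6 h4
    (by rw [orderOf_simple_mul_comm, htr])
  exact ⟨h1, h2, hcomm, h3, h4, h6, h5, h7⟩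

theorem false_of_isRightDescent_of_six_le (cs : CoxeterSystem M W) {s t r : B}
    (hsr : 3 ≤ orderOf (cs.simple s * cs.simple r)) (htr : orderOf (cs.simple t * cs.simple r) = 2)
    (hst : 6 ≤ orderOf (cs.simple s * cs.simple t)) {y : W}
    (ys : cs.IsRightDescent y s) (yr : cs.IsRightDescent y r)
    (ytt : cs.IsRightDescent (y * cs.simple t) t) (ytr : cs.IsRightDescent (y * cs.simple t) r)
    (ytss : cs.IsRightDescent (y * cs.simple t * cs.simple s) s)
    (ytsr : cs.IsRightDescent (y * cs.simple t * cs.simple s) r) : False := by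
  obtain ⟨h1, h2, e, h3, h4, -, h5, h6⟩ := isRightDescent_of_isRightDescent_pairs cs hsr htr
    (by lia) ys yr ytt ytr ytss ytsr
  obtain ⟨-, -, -, -, h7, h8, -⟩ := altDescent_of_isRightDescent cs h1 h2 hst
  rw [e] at h7 h8
  obtain ⟨-, h9, -⟩ := altDescent_of_isRightDescent cs (n := 2) h6 h5
    (by rw [orderOf_simple_mul_comm]; lia)
  obtain ⟨-, h10, -⟩ := altDescent_of_isRightDescent cs (n := 2) h9 h7
    (by rw [orderOf_simple_mul_comm, htr])
  have hlt := (((h7.trans h5).trans h4).trans h3).trans yr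
  exact false_of_isRightDescent_of_six_le cs hsr htr hst h8 h10
    (by rwa [cs.simple_mul_simple_cancel_right]) (by rwa [cs.simple_mul_simple_cancel_right])
    (by rwa [cs.simple_mul_simple_cancel_right, cs.simple_mul_simple_cancel_right])
    (by rwa [cs.simple_mul_simple_cancel_right, cs.simple_mul_simple_cancel_right])
termination_by cs.length y
decreasing_by exact hlt

theorem two_le_orderOf_of_isRightDescent (cs : CoxeterSystem M W) {i j : B} (hij : i ≠ j) {x : W}
    (hi : cs.IsRightDescent x i) (hj : cs.IsRightDescent x j) :
    2 ≤ orderOf (cs.simple i * cs.simple j) := by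
  have h0 := (exists_eq_mul_altProd cs hi hj).1
  have h1 : orderOf (cs.simple i * cs.simple j) ≠ 1 := fun h =>
    hij (simple_injective cs (by
      rw [orderOf_eq_one_iff, mul_eq_one_iff_eq_inv, cs.inv_simple] at h
      exact h))
  lia

theorem eq_two_of_isRightDescent (cs : CoxeterSystem M W) (h2 : TwoDimensional cs) {s t r : B}
    (hst : s ≠ t) (hrs : r ≠ s) (hrt : r ≠ t) (hm : 4 ≤ orderOf (cs.simple s * cs.simple t)) {y : W}
    (ys : cs.IsRightDescent y s) (yr : cs.IsRightDescent y r)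
    (ytt : cs.IsRightDescent (y * cs.simple t) t) (ytr : cs.IsRightDescent (y * cs.simple t) r)
    (ytss : cs.IsRightDescent (y * cs.simple t * cs.simple s) s)
    (ytsr : cs.IsRightDescent (y * cs.simple t * cs.simple s) r) : M.M s r = 2 := by
  by_contra hne
  have ha2 := two_le_orderOf_of_isRightDescent cs hrs.symm ys yr
  have ha : orderOf (cs.simple s * cs.simple r) ≠ 2 := fun h =>
    hne (eq_two_of_commute cs hrs.symm (simple_mul_comm_of_orderOf_eq_two cs h))
  have hb := two_le_orderOf_of_isRightDescent cs hrt.symm ytt ytr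
  by_cases hb2 : orderOf (cs.simple t * cs.simple r) = 2
  · by_cases ha3 : orderOf (cs.simple s * cs.simple r) = 3
    · by_cases hm6 : 6 ≤ orderOf (cs.simple s * cs.simple t)
      · exact false_of_isRightDescent_of_six_le cs ha3.ge hb2 hm6 ys yr ytt ytr ytss ytsr
      · exact (h2 s t r hst hrs.symm hrt.symm).not_finite
          (finite_closure_triple cs ha3 hb2 (by lia))
    · obtain ⟨-, -, -, -, h4, h6, h5, h7⟩ := isRightDescent_of_isRightDescent_pairs cs (by lia) hb2
        hm ys yr ytt ytr ytss ytsr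
      obtain ⟨-, -, -, h8, -⟩ := altDescent_of_isRightDescent cs (n := 4) ys yr (by lia)
      obtain ⟨-, h9, -⟩ := altDescent_of_isRightDescent cs (n := 2) h4 h6 hb
      exact false_of_isRightDescent_of_four_le cs (by lia) hb2 hm h5 h7 h8 h9
  · exact false_of_isRightDescent_of_three_le cs (p := r) (q := s) (o := t)
      (by rw [orderOf_simple_mul_comm]; lia) (by lia) (by lia) yr ys ytt ytr

theorem isResidueBase_piMap (cs : CoxeterSystem M W) {f : W} {i j : B}
    (hTf : descentSet cs f = {i, j}) :
    IsResidueBase cs i j (PiMap cs f) ∧ f⁻¹ * PiMap cs f ∈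
      Subgroup.closure {cs.simple i, cs.simple j} := by
  have hi : cs.IsRightDescent f i := (hTf ▸ .inl rfl : i ∈ descentSet cs f)
  have hj : cs.IsRightDescent f j := (hTf ▸ .inr rfl : j ∈ descentSet cs f)
  have hD : descSubgroup cs f = Subgroup.closure {cs.simple i, cs.simple j} := by
    rw [descSubgroup, hTf, Set.image_pair]
  obtain ⟨ho, z, hz, hf⟩ := exists_eq_mul_altProd cs hi hj
  set u := altProd cs i j (orderOf (cs.simple i * cs.simple j))
  have hu : u ∈ Subgroup.closure {cs.simple i, cs.simple j} := altProd_mem cs i j _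
  have hul : cs.length u = orderOf (cs.simple i * cs.simple j) :=
    length_altProd cs i j (.inr le_rfl)
  have hmax : ∀ v ∈ descSubgroup cs f, cs.length v ≤ cs.length u := by
    rw [hD, hul]
    intro v hv
    obtain ⟨n, hn, rfl | rfl⟩ := exists_eq_altProd cs i j hv
    · rw [length_altProd cs i j hn]; lia
    · rw [length_altProd cs j i (by rwa [orderOf_simple_mul_comm])]; lia
  have hex : ∃ w₀ ∈ descSubgroup cs f, ∀ v ∈ descSubgroup cs f, cs.length v ≤ cs.length w₀ :=
    ⟨u, hD ▸ hu, hmax⟩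
  have hw : wg cs f = u := by
    rw [wg, dif_pos hex]
    refine eq_altProd_of_le_length cs i j ho (hD ▸ hex.choose_spec.1) ?_
    exact hul ▸ hex.choose_spec.2 u (hD ▸ hu)
  have huinv : u⁻¹ = u :=
    eq_altProd_of_le_length cs i j ho (inv_mem hu) (by rw [cs.length_inv, hul])
  have hPi : PiMap cs f = z := by
    rw [PiMap, hw, hf, mul_assoc, mul_eq_one_iff_inv_eq.mpr huinv, mul_one]
  exact ⟨hPi ▸ hz, by rw [PiMap, inv_mul_cancel_left, hw]; exact hu⟩

/-- **Corollary (ii).** If `m = 3`, then `m_sr = 2`. -/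

theorem corollary_step1_ii
    (cs : CoxeterSystem M W) (h2 : TwoDimensional cs)
    (f : W) (i j : B) (hij : i ≠ j) (hTf : descentSet cs f = {i, j})
    (g : W) (hgR : f⁻¹ * g ∈ Subgroup.closure {cs.simple i, cs.simple j})
    (k : B) (hki : k ≠ i) (hkj : k ≠ j) (hTg : descentSet cs g = {i, k})
    (hm : cs.length ((PiMap cs f)⁻¹ * g) = 3) :
    M.M i k = 2 := by
  have gi : cs.IsRightDescent g i := (hTg ▸ .inl rfl : i ∈ descentSet cs g)
  have gk : cs.IsRightDescent g k := (hTg ▸ .inr rfl : k ∈ descentSet cs g)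
  have gj : ¬ cs.IsRightDescent g j := fun h => by
    have : j ∈ descentSet cs g := h
    rw [hTg] at this
    rcases this with h | h
    exacts [hij h.symm, hkj h.symm]
  obtain ⟨hz, hmem⟩ := isResidueBase_piMap cs hTf
  have hv : (PiMap cs f)⁻¹ * g ∈ Subgroup.closure {cs.simple i, cs.simple j} := by
    simpa [mul_assoc] using mul_mem (inv_mem hmem) hgR
  set z := PiMap cs f
  have hgv : g = z * (z⁻¹ * g) := by simp
  rw [hgv, hz _ hv _ (.inr rfl)] at gj
  have hvji : z⁻¹ * g = altProd cs j i 3 ∧ 4 ≤ orderOf (cs.simple i * cs.simple j) := by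
    have hn0 := (exists_eq_mul_altProd cs (x := f) (hTf ▸ .inl rfl : i ∈ descentSet cs f)
      (hTf ▸ .inr rfl : j ∈ descentSet cs f)).1
    obtain ⟨n, hn, h | h⟩ := exists_eq_altProd cs i j hv
    · rw [h, length_altProd cs i j hn] at hm
      subst hm
      exact absurd (h ▸ isRightDescent_altProd cs i j (by lia) hn) gj
    · rw [h, length_altProd cs j i (by rwa [orderOf_simple_mul_comm])] at hm
      subst hm
      refine ⟨h, ?_⟩
      by_contra hlt
      rw [h, ← (altProd_eq_swap_iff cs i j 3).mpr (by
        rw [show 3 = orderOf (cs.simple i * cs.simple j) by lia, pow_orderOf_eq_one])] at gj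
      exact gj (isRightDescent_altProd cs i j (by lia) hn)
  obtain ⟨hvji, h4⟩ := hvji
  have hg : g = z * altProd cs j i 3 := by rw [← hvji, ← hgv]
  obtain ⟨-, gsj, gsts, -⟩ := hg ▸ hz.symm.altDescent (n := 3)
    (by rw [orderOf_simple_mul_comm]; lia)
  obtain ⟨-, gsk, -⟩ := altDescent_of_isRightDescent cs (n := 2) gk gi
    (by rw [orderOf_simple_mul_comm]; exact two_le_orderOf_of_isRightDescent cs hki.symm gi gk)
  obtain ⟨-, gstk, -⟩ := altDescent_of_isRightDescent cs (n := 2) gsk gsj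
    (two_le_orderOf_of_isRightDescent cs hkj gsk gsj)
  exact eq_two_of_isRightDescent cs h2 hij hki hkj h4 gsts gstk
    (by rwa [cs.simple_mul_simple_cancel_right]) (by rwa [cs.simple_mul_simple_cancel_right])
    (by rwa [cs.simple_mul_simple_cancel_right, cs.simple_mul_simple_cancel_right])
    (by rwa [cs.simple_mul_simple_cancel_right, cs.simple_mul_simple_cancel_right])

end CoxeterPaper
end

section
/- Let W be a 2-dimensional Coxeter group. Let f ∈ W with T(f) = {s, t} for distinct s, t ∈ S (so that m_st < ∞), let h = Π(f), and let R = f⟨s,t⟩ be the {s,t}-residue containing f and h. Let g ∈ R, let m = ℓ(h⁻¹g), and suppose T(g) = {s, r} for some r ∈ S with r ∉ {s, t}. If m = m_st − 1, then m_st ≤ 3; moreover if additionally m_st = 3, then m_sr = 2. -/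
namespace CoxeterPaper

open CoxeterSystem

attribute [local instance] Classical.propDecidable

variable {B : Type} [DecidableEq B] [Fintype B]
variable {W : Type} [Group W] {M : CoxeterMatrix B}

end CoxeterPaper

namespace CoxeterMatrix

open Polynomial.Chebyshev

variable {B : Type*} (M : CoxeterMatrix B)

/-- The linear form `v ↦ 2 ⟪e i, v⟫` for the canonical bilinear form of a Coxeter matrix. -/
noncomputable def coroot (i : B) : Module.Dual ℝ (B →₀ ℝ) :=
  Finsupp.linearCombination ℝ fun j ↦ -(2 * Real.cos (Real.pi / M i j))

theorem coroot_single (i j : B) :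
    M.coroot i (Finsupp.single j 1) = -(2 * Real.cos (Real.pi / M i j)) := by
  simp [coroot]

theorem coroot_single_self (i : B) : M.coroot i (Finsupp.single i 1) = 2 := by
  simp [coroot_single]

/-- The reflection attached to a generator in the geometric representation. -/
noncomputable def geometricReflection (i : B) : (B →₀ ℝ) ≃ₗ[ℝ] (B →₀ ℝ) :=
  Module.reflection (M.coroot_single_self i)

theorem coroot_mul_coroot_sub_two (i j : B) :
    M.coroot i (Finsupp.single j 1) * M.coroot j (Finsupp.single i 1) - 2 =
      2 * Real.cos (2 * (Real.pi / M i j)) := by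
  rw [coroot_single, coroot_single, M.symmetric j i, Real.cos_two_mul]
  ring

theorem sin_two_mul_pi_div_ne_zero {m : ℕ} (hm : 3 ≤ m) : Real.sin (2 * (Real.pi / m)) ≠ 0 := by
  have h3 : (3 : ℝ) ≤ m := by exact_mod_cast hm
  have hpi := Real.pi_pos
  refine (Real.sin_pos_of_pos_of_lt_pi (by positivity) ?_).ne'
  rw [← mul_div_assoc, div_lt_iff₀ (by positivity)]
  nlinarith

theorem geometricReflection_isLiftable : M.IsLiftable M.geometricReflection := by
  intro i j
  rcases eq_or_ne i j with rfl | hij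
  · rw [M.diagonal, pow_one]
    rw [geometricReflection, ← eq_inv_iff_mul_eq_one, Module.reflection_inv]
  obtain h0 | h2 | h3 : M i j = 0 ∨ M i j = 2 ∨ 3 ≤ M i j := by
    have := M.off_diagonal i j hij
    omega
  · rw [h0, pow_zero]
  · have hij0 : M.coroot i (Finsupp.single j 1) = 0 := by simp [coroot_single, h2]
    have hji0 : M.coroot j (Finsupp.single i 1) = 0 := by
      simp [coroot_single, M.symmetric j i, h2]
    rw [h2, pow_two]
    apply LinearEquiv.ext
    intro v
    simp only [geometricReflection, LinearEquiv.mul_apply, Module.reflection_apply, map_sub,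
      map_smul, hij0, hji0, coroot_single_self, LinearEquiv.coe_one, id]
    module
  · have hsin := sin_two_mul_pi_div_ne_zero h3
    have hm : (M i j : ℝ) ≠ 0 := by
      have : M i j ≠ 0 := by omega
      exact_mod_cast this
    have hS (n : ℤ) := S_two_mul_real_cos (2 * (Real.pi / M i j)) n
    apply LinearEquiv.ext
    intro v
    rw [geometricReflection, geometricReflection, Module.reflection_mul_reflection_pow_apply,
      coroot_mul_coroot_sub_two]
    generalize M i j = m at *
    set φ := 2 * (Real.pi / m) with hφ
    have hmφ : (m : ℝ) * φ = 2 * Real.pi := by rw [hφ]; field_simp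
    obtain ⟨k, rfl | rfl⟩ := Nat.even_or_odd' m
    · have e1 : (((2 * k : ℕ) : ℤ) - 2) / 2 = k - 1 := by omega
      have e2 : (((2 * k : ℕ) : ℤ) - 1) / 2 = k - 1 := by omega
      have hz : (S ℝ (k - 1)).eval (2 * Real.cos φ) = 0 := by
        have := hS (k - 1)
        have h' : (((k : ℤ) - 1 : ℤ) + 1 : ℝ) * φ = Real.pi := by
          push_cast at hmφ ⊢; linarith
        rw [h', Real.sin_pi] at this
        exact (mul_eq_zero.mp this).resolve_right hsin
      rw [e1, e2, hz]
      simp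
    · have e1 : (((2 * k + 1 : ℕ) : ℤ) - 2) / 2 = k - 1 := by omega
      have e2 : (((2 * k + 1 : ℕ) : ℤ) - 1) / 2 = k := by omega
      have e3 : (((2 * k + 1 : ℕ) : ℤ) - 3) / 2 = k - 1 := by omega
      have e4 : (((2 * k + 1 : ℕ) : ℤ)) / 2 = k := by omega
      have hz : (S ℝ k).eval (2 * Real.cos φ) + (S ℝ (k - 1)).eval (2 * Real.cos φ) = 0 := by
        refine (mul_eq_zero.mp ?_).resolve_right hsin
        rw [add_mul, hS, hS]
        have h' : (((k : ℤ) : ℝ) + 1) * φ = 2 * Real.pi - (((k : ℤ) - 1 : ℤ) + 1 : ℝ) * φ := by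
          push_cast at hmφ ⊢; linarith
        rw [h', Real.sin_two_pi_sub, neg_add_cancel]
      rw [e1, e2, e3, e4, hz]
      simp

theorem dvd_of_geometricReflection_pow_eq_one {i j : B} (hij : i ≠ j) {k : ℕ}
    (hk : (M.geometricReflection i * M.geometricReflection j) ^ k = 1) : M i j ∣ k := by
  have h := congrArg (fun e : (B →₀ ℝ) ≃ₗ[ℝ] (B →₀ ℝ) ↦ e (Finsupp.single i 1)) hk
  simp only [geometricReflection] at h
  rw [Module.reflection_mul_reflection_pow_apply_self, coroot_mul_coroot_sub_two] at h
  have hi := DFunLike.congr_fun h i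
  have hj := DFunLike.congr_fun h j
  simp [hij, hij.symm, coroot_single, M.symmetric j i] at hi hj
  obtain h0 | h2 | h3 : M i j = 0 ∨ M i j = 2 ∨ 3 ≤ M i j := by
    have := M.off_diagonal i j hij
    omega
  · rw [h0] at hj ⊢
    simpa [S_eval_two] using hj
  · rw [h2] at hi ⊢
    have hc : 2 * Real.cos (2 * (Real.pi / (2 : ℕ))) = -2 := by
      rw [Nat.cast_two, mul_div_cancel₀ _ two_ne_zero, Real.cos_pi]; norm_num
    rw [hc, S_eval_neg_two, S_eval_neg_two] at hi
    by_contra hodd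
    have ho : Odd k := by rwa [← Nat.not_even_iff_odd, even_iff_two_dvd]
    have ho' : Odd (k : ℤ) := by exact_mod_cast ho
    rw [Int.negOnePow_odd _ ho', Int.negOnePow_even _ (ho'.sub_odd odd_one)] at hi
    push_cast at hi
    norm_num at hi
  · have hsin := sin_two_mul_pi_div_ne_zero h3
    have hpi := Real.pi_pos
    have hm : (M i j : ℝ) ≠ 0 := by
      have : M i j ≠ 0 := by omega
      exact_mod_cast this
    have hcos : Real.cos (Real.pi / M i j) ≠ 0 := by
      intro hc
      rw [Real.sin_two_mul, hc] at hsin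
      simp at hsin
    have hS (n : ℤ) := S_two_mul_real_cos (2 * (Real.pi / M i j)) n
    rw [or_iff_left hcos] at hj
    rw [hj, add_zero] at hi
    have h1 := hS k
    have h2 := hS (k - 1)
    rw [hi] at h1
    rw [hj] at h2
    push_cast at h1 h2
    rw [add_mul, one_mul, one_mul, Real.sin_add] at h1
    rw [zero_mul, sub_add_cancel] at h2
    rw [← h2, zero_mul, zero_add] at h1
    have h4 : Real.cos (k * (2 * (Real.pi / M i j))) = 1 :=
      mul_right_cancel₀ hsin (by rw [one_mul]; exact h1.symm)
    obtain ⟨z, hz⟩ := (Real.cos_eq_one_iff _).mp h4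
    have hz' : (k : ℝ) = M i j * z := by
      field_simp at hz
      linarith
    have : (k : ℤ) = M i j * z := by exact_mod_cast hz'
    exact Int.natCast_dvd_natCast.mp ⟨z, this⟩

end CoxeterMatrix

theorem Function.End.mul_apply {α : Type*} (f g : Function.End α) (a : α) : (f * g) a = f (g a) :=
  rfl

theorem Function.End.one_apply {α : Type*} (a : α) : (1 : Function.End α) a = a :=
  rfl

namespace CoxeterSystem

variable {B W : Type*} [Group W] {M : CoxeterMatrix B} (cs : CoxeterSystem M W)

attribute [local instance] Classical.propDecidable

theorem simple_mul_simple_pow_eq_one_iff {i j : B} (hij : i ≠ j) {k : ℕ} :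
    (cs.simple i * cs.simple j) ^ k = 1 ↔ M i j ∣ k := by
  refine ⟨fun h ↦ ?_, fun ⟨c, hc⟩ ↦ by rw [hc, pow_mul, simple_mul_simple_pow, one_pow]⟩
  apply M.dvd_of_geometricReflection_pow_eq_one hij
  have := congrArg (cs.lift ⟨_, M.geometricReflection_isLiftable⟩) h
  simpa using this

/-- The action of a generator on `W × ZMod 2` which conjugates the first component and records
in the second one whether it was that generator. -/
noncomputable def signedConj (i : B) : Function.End (W × ZMod 2) := fun p ↦
  (cs.simple i * p.1 * cs.simple i, p.2 + if p.1 = cs.simple i then 1 else 0)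

theorem signedConj_mul_pow_apply (i j : B) (k : ℕ) (p : W × ZMod 2) :
    ((cs.signedConj i * cs.signedConj j) ^ k) p =
      ((cs.simple i * cs.simple j) ^ k * p.1 * ((cs.simple i * cs.simple j) ^ k)⁻¹,
        p.2 + ∑ l ∈ Finset.range (2 * k),
          if p.1 = cs.simple j * (cs.simple i * cs.simple j) ^ l then 1 else 0) := by
  set x := cs.simple i * cs.simple j with hx
  have hxs : cs.simple j * x * cs.simple j = x⁻¹ := by simp [hx, mul_assoc]
  have hconj (l : ℕ) : cs.simple j * x ^ l * cs.simple j = (x ^ l)⁻¹ := by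
    rw [← inv_pow, ← hxs]
    induction l with
    | zero => simp
    | succ l ih => rw [pow_succ, pow_succ, ← ih]; simp [mul_assoc]
  have hcomm (l : ℕ) : (x ^ l)⁻¹ * cs.simple j = cs.simple j * x ^ l := by
    rw [← hconj]; simp [mul_assoc]
  induction k with
  | zero => simp [Function.End.one_apply]
  | succ k ih =>
    rw [pow_succ', Function.End.mul_apply, ih, Function.End.mul_apply]
    simp only [signedConj]
    refine Prod.ext ?_ ?_
    · rw [pow_succ' x k]
      simp [hx, mul_assoc]
    · have h1 : x ^ k * p.1 * (x ^ k)⁻¹ = cs.simple j ↔ p.1 = cs.simple j * x ^ (2 * k) := by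
        rw [mul_inv_eq_iff_eq_mul, ← eq_inv_mul_iff_mul_eq, ← mul_assoc, hcomm, mul_assoc,
          ← pow_add, two_mul]
      have h2 : cs.simple j * (x ^ k * p.1 * (x ^ k)⁻¹) * cs.simple j = cs.simple i ↔
          p.1 = cs.simple j * x ^ (2 * k + 1) := by
        have : cs.simple j * (x ^ k * p.1 * (x ^ k)⁻¹) * cs.simple j = cs.simple i ↔
            x ^ k * p.1 * (x ^ k)⁻¹ = cs.simple j * x := by
          rw [hx, ← mul_assoc (cs.simple j) (cs.simple i),
            ← eq_mul_inv_iff_mul_eq, ← eq_inv_mul_iff_mul_eq]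
          simp [mul_assoc]
        rw [this, mul_inv_eq_iff_eq_mul, ← eq_inv_mul_iff_mul_eq, mul_assoc, ← mul_assoc, hcomm,
          mul_assoc, ← pow_succ', ← pow_add]
        ring_nf
      rw [mul_add, mul_one, Finset.sum_range_succ, Finset.sum_range_succ]
      simp only [h1, h2, add_assoc]

theorem signedConj_isLiftable : M.IsLiftable cs.signedConj := by
  intro i j
  funext p
  rw [signedConj_mul_pow_apply, simple_mul_simple_pow, two_mul, Finset.sum_range_add]
  simp only [pow_add, simple_mul_simple_pow, one_mul, CharTwo.add_self_eq_zero]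
  simp [Function.End.one_apply]

/-- The parity with which conjugates of `w` occur in the right inversion sequence of a word
for `g`. -/
noncomputable def inversionParity (g w : W) : ZMod 2 :=
  (cs.lift ⟨_, cs.signedConj_isLiftable⟩ g (w, 0)).2

theorem lift_signedConj_wordProd_apply (ω : List B) (w : W) (e : ZMod 2) :
    cs.lift ⟨_, cs.signedConj_isLiftable⟩ (cs.wordProd ω) (w, e) =
      (cs.wordProd ω * w * (cs.wordProd ω)⁻¹, e + (cs.rightInvSeq ω).count w) := by
  induction ω with
  | nil => simp [Function.End.one_apply]
  | cons i ω ih =>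
    rw [wordProd_cons, map_mul, Function.End.mul_apply, ih, lift_apply_simple,
      signedConj, rightInvSeq, List.count_cons]
    have : cs.wordProd ω * w * (cs.wordProd ω)⁻¹ = cs.simple i ↔
        (cs.wordProd ω)⁻¹ * cs.simple i * cs.wordProd ω = w := by
      rw [mul_inv_eq_iff_eq_mul, ← eq_inv_mul_iff_mul_eq, eq_comm, mul_assoc]
    simp only [mul_assoc] at this
    simp [this, mul_assoc, add_assoc]

theorem inversionParity_wordProd (ω : List B) (w : W) :
    cs.inversionParity (cs.wordProd ω) w = (cs.rightInvSeq ω).count w := by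
  rw [inversionParity, lift_signedConj_wordProd_apply, zero_add]

theorem inversionParity_mul (g h w : W) :
    cs.inversionParity (g * h) w =
      cs.inversionParity g (h * w * h⁻¹) + cs.inversionParity h w := by
  obtain ⟨ω, rfl⟩ := cs.wordProd_surjective g
  obtain ⟨ω', rfl⟩ := cs.wordProd_surjective h
  rw [inversionParity, map_mul, Function.End.mul_apply,
    lift_signedConj_wordProd_apply, lift_signedConj_wordProd_apply, inversionParity_wordProd,
    inversionParity_wordProd, zero_add, add_comm]

theorem inversionParity_simple (i : B) (w : W) :
    cs.inversionParity (cs.simple i) w = if w = cs.simple i then 1 else 0 := by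
  have h := cs.inversionParity_wordProd [i] w
  rw [wordProd_singleton] at h
  rw [h]
  simp only [rightInvSeq_singleton, List.count_singleton, beq_iff_eq, eq_comm (a := w)]
  split_ifs <;> rfl

theorem length_mul_lt_of_inversionParity_ne_zero {g w : W} (h : cs.inversionParity g w ≠ 0) :
    cs.length (g * w) < cs.length g := by
  obtain ⟨ω, hω, rfl⟩ := cs.exists_isReduced g
  rw [inversionParity_wordProd] at h
  have hmem : w ∈ cs.rightInvSeq ω := by
    by_contra hw
    rw [List.count_eq_zero_of_not_mem hw] at h
    exact h Nat.cast_zero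
  exact (cs.isRightInversion_of_mem_rightInvSeq hω hmem).2

theorem inversionParity_simple_eq_one_iff {g : W} {i : B} :
    cs.inversionParity g (cs.simple i) = 1 ↔ cs.IsRightDescent g i := by
  refine ⟨fun h ↦ cs.length_mul_lt_of_inversionParity_ne_zero (by rw [h]; exact one_ne_zero),
    fun h ↦ ?_⟩
  by_contra hne
  have h0 : cs.inversionParity g (cs.simple i) = 0 := by
    generalize cs.inversionParity g (cs.simple i) = z at hne
    decide +revert
  have := cs.length_mul_lt_of_inversionParity_ne_zero (g := g * cs.simple i) (w := cs.simple i)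
    (by simp [inversionParity_mul, inversionParity_simple, h0])
  rw [simple_mul_simple_cancel_right] at this
  exact lt_asymm this h

theorem inversionParity_alternatingWord (i j : B) (k : ℕ) (w : W) :
    cs.inversionParity (cs.wordProd (alternatingWord i j k)) w =
      ∑ l ∈ Finset.range k,
        if w = cs.simple j * (cs.simple i * cs.simple j) ^ l then 1 else 0 := by
  induction k generalizing i j w with
  | zero => rw [alternatingWord, inversionParity_wordProd]; simp
  | succ k ih =>
    rw [alternatingWord_succ, wordProd_concat, inversionParity_mul, ih, inversionParity_simple,
      Finset.sum_range_succ', pow_zero, mul_one]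
    congr 1
    refine Finset.sum_congr rfl fun l _ ↦ if_congr ?_ rfl rfl
    have : cs.simple j * (cs.simple i * cs.simple j) ^ (l + 1) =
        cs.simple j * (cs.simple i * (cs.simple j * cs.simple i) ^ l) * cs.simple j := by
      have hcomm : (cs.simple i * cs.simple j) ^ l * cs.simple i =
          cs.simple i * (cs.simple j * cs.simple i) ^ l := mul_pow_mul _ _ _
      rw [← hcomm, pow_succ]
      simp only [mul_assoc]
    rw [this, inv_simple, ← eq_mul_inv_iff_mul_eq (c := cs.simple j), ← eq_inv_mul_iff_mul_eq]
    simp [mul_assoc]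

end CoxeterSystem

namespace CoxeterSystem

variable {B W : Type*} [Group W] {M : CoxeterMatrix B} (cs : CoxeterSystem M W)

theorem isRightDescent_alternatingWord_right {i j : B} (hij : i ≠ j) {k : ℕ} (hk : 0 < k)
    (hkM : M i j = 0 ∨ k ≤ M i j) :
    cs.IsRightDescent (cs.wordProd (alternatingWord i j k)) j := by
  rw [← inversionParity_simple_eq_one_iff, inversionParity_alternatingWord,
    Finset.sum_eq_single_of_mem 0 (Finset.mem_range.mpr hk)]
  · simp
  · intro l hl hl0
    refine if_neg fun h ↦ ?_
    rw [left_eq_mul, cs.simple_mul_simple_pow_eq_one_iff hij] at h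
    have hlk := Finset.mem_range.mp hl
    rcases hkM with h0 | hle
    · rw [h0, zero_dvd_iff] at h
      exact hl0 h
    · have := Nat.le_of_dvd (Nat.pos_of_ne_zero hl0) h
      omega

theorem not_isRightDescent_alternatingWord_left {i j : B} (hij : i ≠ j) {k : ℕ}
    (hkM : M i j = 0 ∨ k < M i j) :
    ¬ cs.IsRightDescent (cs.wordProd (alternatingWord i j k)) i := by
  rw [← inversionParity_simple_eq_one_iff, inversionParity_alternatingWord,
    Finset.sum_eq_zero]
  · exact zero_ne_one
  · intro l hl
    refine if_neg fun h ↦ ?_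
    have h' : (cs.simple i * cs.simple j) ^ (l + 1) = 1 := by
      rw [pow_succ', mul_assoc, ← h, simple_mul_simple_self]
    rw [cs.simple_mul_simple_pow_eq_one_iff hij] at h'
    have hlk := Finset.mem_range.mp hl
    rcases hkM with h0 | hle
    · rw [h0, zero_dvd_iff] at h'
      omega
    · have := Nat.le_of_dvd (Nat.succ_pos l) h'
      omega

theorem wordProd_alternatingWord_succ_mul (i j : B) (k : ℕ) :
    cs.wordProd (alternatingWord i j (k + 1)) * cs.simple j =
      cs.wordProd (alternatingWord j i k) := by
  rw [alternatingWord_succ, wordProd_concat, simple_mul_simple_cancel_right]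

theorem length_alternatingWord_of_le {i j : B} (hij : i ≠ j) {k : ℕ} (hkM : k ≤ M i j) :
    cs.length (cs.wordProd (alternatingWord i j k)) = k := by
  induction k generalizing i j with
  | zero => simp [alternatingWord]
  | succ k ih =>
    have h := cs.isRightDescent_alternatingWord_right hij k.succ_pos (.inr hkM)
    rw [isRightDescent_iff, wordProd_alternatingWord_succ_mul,
      ih hij.symm (by rw [M.symmetric]; omega)] at h
    exact h.symm

theorem exists_alternatingWord_of_mem_closure {i j : B} {d : W}
    (hd : d ∈ Subgroup.closure {cs.simple i, cs.simple j}) :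
    ∃ k, (M i j = 0 ∨ k ≤ M i j) ∧ (d = cs.wordProd (alternatingWord i j k) ∨
      d = cs.wordProd (alternatingWord j i k)) := by
  have step (a b : B) (k : ℕ) (hk : M a b = 0 ∨ k ≤ M a b) :
      ∃ k', (M a b = 0 ∨ k' ≤ M a b) ∧
        (cs.wordProd (alternatingWord a b k) * cs.simple b =
            cs.wordProd (alternatingWord a b k') ∨
          cs.wordProd (alternatingWord a b k) * cs.simple b =
            cs.wordProd (alternatingWord b a k')) := by
    rcases k with _ | k
    · by_cases h0 : M a b = 0
      · exact ⟨1, .inl h0, .inl (by simp [alternatingWord])⟩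
      · exact ⟨1, .inr (by omega), .inl (by simp [alternatingWord])⟩
    · exact ⟨k, hk.imp_right fun h ↦ by omega, .inr (cs.wordProd_alternatingWord_succ_mul a b k)⟩
  have step' (a b : B) (k : ℕ) (hk : M a b = 0 ∨ k ≤ M a b) :
      ∃ k', (M a b = 0 ∨ k' ≤ M a b) ∧
        (cs.wordProd (alternatingWord b a k) * cs.simple b =
            cs.wordProd (alternatingWord a b k') ∨
          cs.wordProd (alternatingWord b a k) * cs.simple b =
            cs.wordProd (alternatingWord b a k')) := by
    by_cases hlt : M a b = 0 ∨ k < M a b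
    · exact ⟨k + 1, hlt, .inl (by rw [alternatingWord_succ, wordProd_concat])⟩
    · have hkM : k = M a b := by omega
      have hbraid : cs.wordProd (alternatingWord b a k) = cs.wordProd (alternatingWord a b k) := by
        rw [hkM]
        nth_rw 1 [M.symmetric]
        exact cs.wordProd_braidWord_eq b a
      rw [hbraid]
      exact step a b k hk
  have step_right (a b : B) (x : W) (h : ∃ k, (M a b = 0 ∨ k ≤ M a b) ∧
      (x = cs.wordProd (alternatingWord a b k) ∨ x = cs.wordProd (alternatingWord b a k))) :
      ∃ k, (M a b = 0 ∨ k ≤ M a b) ∧ (x * cs.simple b = cs.wordProd (alternatingWord a b k) ∨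
        x * cs.simple b = cs.wordProd (alternatingWord b a k)) := by
    obtain ⟨k, hk, rfl | rfl⟩ := h
    exacts [step a b k hk, step' a b k hk]
  have step_either (x y : W) (hy : y ∈ ({cs.simple i, cs.simple j} : Set W))
      (h : ∃ k, (M i j = 0 ∨ k ≤ M i j) ∧
        (x = cs.wordProd (alternatingWord i j k) ∨ x = cs.wordProd (alternatingWord j i k))) :
      ∃ k, (M i j = 0 ∨ k ≤ M i j) ∧ (x * y = cs.wordProd (alternatingWord i j k) ∨
        x * y = cs.wordProd (alternatingWord j i k)) := by
    obtain rfl | rfl := hy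
    · simp only [M.symmetric i j, or_comm (a := _ = cs.wordProd (alternatingWord i j _))] at h ⊢
      exact step_right j i x h
    · exact step_right i j x h
  induction hd using Subgroup.closure_induction_right with
  | one => exact ⟨0, .inr (Nat.zero_le _), .inl (by simp [alternatingWord])⟩
  | mul_right x _ y hy ih => exact step_either x y hy ih
  | mul_inv_cancel x _ y hy ih =>
    have hinv : y⁻¹ = y := by obtain rfl | rfl := hy <;> exact cs.inv_simple _
    rw [hinv]
    exact step_either x y hy ih

/-- `y` has no inversions in the dihedral subgroup generated by `i` and `j`, so it is the shortest
element of its residue. -/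
def IsResidueMin (i j : B) (y : W) : Prop :=
  ∀ d ∈ Subgroup.closure {cs.simple i, cs.simple j}, cs.inversionParity y d = 0

variable {cs}

theorem IsResidueMin.symm {i j : B} {y : W} (hy : cs.IsResidueMin i j y) :
    cs.IsResidueMin j i y := by
  rwa [IsResidueMin, Set.pair_comm]

theorem IsResidueMin.isRightDescent_mul_iff {i j : B} {y d : W} (hy : cs.IsResidueMin i j y)
    (hd : d ∈ Subgroup.closure {cs.simple i, cs.simple j}) {k : B} (hk : k = i ∨ k = j) :
    cs.IsRightDescent (y * d) k ↔ cs.IsRightDescent d k := by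
  have hks : cs.simple k ∈ Subgroup.closure {cs.simple i, cs.simple j} :=
    Subgroup.subset_closure (by rcases hk with rfl | rfl <;> simp)
  rw [← inversionParity_simple_eq_one_iff, ← inversionParity_simple_eq_one_iff,
    inversionParity_mul, hy _ (mul_mem (mul_mem hd hks) (inv_mem hd)), zero_add]

theorem wordProd_alternatingWord_mem_closure (cs : CoxeterSystem M W) (i j : B) (k : ℕ) :
    cs.wordProd (alternatingWord i j k) ∈ Subgroup.closure {cs.simple i, cs.simple j} := by
  have hi : cs.simple i ∈ Subgroup.closure {cs.simple i, cs.simple j} :=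
    Subgroup.subset_closure (by simp)
  have hj : cs.simple j ∈ Subgroup.closure {cs.simple i, cs.simple j} :=
    Subgroup.subset_closure (by simp)
  rw [prod_alternatingWord_eq_mul_pow]
  refine mul_mem ?_ (pow_mem (mul_mem hi hj) _)
  split_ifs
  exacts [one_mem _, hj]

theorem exists_isResidueMin_mul (cs : CoxeterSystem M W) (i j : B) (x : W) :
    ∃ y, cs.IsResidueMin i j y ∧
      ∃ d ∈ Subgroup.closure {cs.simple i, cs.simple j}, x = y * d := by
  set D := Subgroup.closure {cs.simple i, cs.simple j}
  obtain ⟨d, -, hmin⟩ := (measure fun d : D ↦ cs.length (x * d)).wf.has_min Set.univ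
    ⟨1, trivial⟩
  refine ⟨x * d, fun e he ↦ ?_, d⁻¹, inv_mem d.2, by simp⟩
  by_contra hne
  refine hmin (d * ⟨e, he⟩) trivial ?_
  have := cs.length_mul_lt_of_inversionParity_ne_zero hne
  rwa [mul_assoc] at this

/-- The element `x` is the product of the shortest element of its residue and the alternating word
of length `k ≤ M i j` ending with `j`. -/
def IsResidueAlternating (cs : CoxeterSystem M W) (i j : B) (k : ℕ) (x : W) : Prop :=
  k ≤ M i j ∧ ∃ y, cs.IsResidueMin i j y ∧ x = y * cs.wordProd (alternatingWord i j k)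

theorem IsResidueAlternating.mul_simple {i j : B} {k : ℕ} {x : W}
    (hx : cs.IsResidueAlternating i j (k + 1) x) :
    cs.IsResidueAlternating j i k (x * cs.simple j) := by
  obtain ⟨hk, y, hy, rfl⟩ := hx
  refine ⟨by rw [M.symmetric]; omega, y, hy.symm, ?_⟩
  rw [mul_assoc, wordProd_alternatingWord_succ_mul]

theorem IsResidueAlternating.isRightDescent {i j : B} (hij : i ≠ j) {k : ℕ} {x : W}
    (hx : cs.IsResidueAlternating i j k x) (hk : 0 < k) : cs.IsRightDescent x j := by
  obtain ⟨hkM, y, hy, rfl⟩ := hx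
  rw [hy.isRightDescent_mul_iff (cs.wordProd_alternatingWord_mem_closure i j k) (.inr rfl)]
  exact cs.isRightDescent_alternatingWord_right hij hk (.inr hkM)

theorem isResidueAlternating_of_isRightDescent (cs : CoxeterSystem M W) {i j : B} (hij : i ≠ j)
    {x : W} (hi : cs.IsRightDescent x i) (hj : cs.IsRightDescent x j) :
    M i j ≠ 0 ∧ cs.IsResidueAlternating i j (M i j) x := by
  obtain ⟨y, hy, d, hd, rfl⟩ := cs.exists_isResidueMin_mul i j x
  rw [hy.isRightDescent_mul_iff hd (.inl rfl)] at hi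
  rw [hy.isRightDescent_mul_iff hd (.inr rfl)] at hj
  obtain ⟨k, hk, rfl | rfl⟩ := cs.exists_alternatingWord_of_mem_closure hd
  · have hk' : ¬ (M i j = 0 ∨ k < M i j) := fun h ↦
      cs.not_isRightDescent_alternatingWord_left hij h hi
    obtain rfl : k = M i j := by omega
    exact ⟨by omega, le_rfl, y, hy, rfl⟩
  · rw [M.symmetric] at hk
    have hk' : ¬ (M j i = 0 ∨ k < M j i) := fun h ↦
      cs.not_isRightDescent_alternatingWord_left hij.symm h hj
    obtain rfl : k = M j i := by omega
    exact ⟨by rw [M.symmetric]; omega, le_rfl, y, hy, by rw [cs.wordProd_braidWord_eq]⟩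

theorem IsResidueAlternating.mul_simple_of_pos {i j : B} {k : ℕ} {x : W}
    (hx : cs.IsResidueAlternating i j k x) (hk : 0 < k) :
    cs.IsResidueAlternating j i (k - 1) (x * cs.simple j) := by
  rw [← Nat.sub_add_cancel hk] at hx
  exact hx.mul_simple

/-- If `i` and `j` are descents of `x`, then going down from `x` by `j` leads to an element
which is not the bottom of its residue. -/
theorem isResidueAlternating_mul_simple_of_isRightDescent (cs : CoxeterSystem M W) {i j : B}
    (hij : i ≠ j) {x : W} (hi : cs.IsRightDescent x i) (hj : cs.IsRightDescent x j) :
    2 ≤ M i j ∧ cs.IsResidueAlternating j i (M i j - 1) (x * cs.simple j) := by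
  obtain ⟨h0, h⟩ := cs.isResidueAlternating_of_isRightDescent hij hi hj
  have := M.off_diagonal i j hij
  exact ⟨by omega, h.mul_simple_of_pos (by omega)⟩

theorem simple_commute_of_eq_two (cs : CoxeterSystem M W) {i j : B} (h : M i j = 2) :
    Commute (cs.simple i) (cs.simple j) := by
  have hpow := cs.simple_mul_simple_pow i j
  rw [h, pow_two, ← eq_inv_iff_mul_eq_one, mul_inv_rev, inv_simple, inv_simple] at hpow
  exact hpow

theorem not_isRightDescent_mul_simple_of_three_le (cs : CoxeterSystem M W) {i j k : B}
    (hij : i ≠ j) (hik : i ≠ k) (hjk : j ≠ k) (hn : 3 ≤ M i j) (hp : 3 ≤ M i k)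
    (hq : 3 ≤ M j k) {x : W} (hi : cs.IsRightDescent x i) (hj : cs.IsRightDescent x j) :
    ¬ cs.IsRightDescent (x * cs.simple j) k := by
  intro hk
  induction hx : cs.length x using Nat.strong_induction_on generalizing x with | _ l ih
  subst hx
  have hgij := (cs.isResidueAlternating_mul_simple_of_isRightDescent hij hi hj).2
  have hgi := hgij.isRightDescent hij.symm (by omega)
  have hg₁ij := hgij.mul_simple_of_pos (by omega)
  have hg₁j := hg₁ij.isRightDescent hij (by omega)
  have hg₁ik := (cs.isResidueAlternating_mul_simple_of_isRightDescent hik.symm hk hgi).2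
  rw [M.symmetric k i] at hg₁ik
  have hg₁k := hg₁ik.isRightDescent hik (by omega)
  have hyik := hg₁ik.mul_simple_of_pos (by omega)
  have hyi := hyik.isRightDescent hik.symm (by omega)
  have hyjk := (cs.isResidueAlternating_mul_simple_of_isRightDescent hjk hg₁j hg₁k).2
  have hyj := hyjk.isRightDescent hjk.symm (by omega)
  have hzjk := hyjk.mul_simple_of_pos (by omega)
  have hzk := hzjk.isRightDescent hjk (by omega)
  exact ih _ (hg₁k.trans <| hgi.trans hj) hyi hyj hzk rfl

theorem not_isRightDescent_mul_simple_of_four_le (cs : CoxeterSystem M W) {i j k : B}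
    (hij : i ≠ j) (hik : i ≠ k) (hjk : j ≠ k) (hn : 4 ≤ M i j) (hq : 4 ≤ M j k) {x : W}
    (hi : cs.IsRightDescent x i) (hj : cs.IsRightDescent x j) :
    ¬ cs.IsRightDescent (x * cs.simple j) k := by
  intro hk
  induction hx : cs.length x using Nat.strong_induction_on generalizing x with | _ l ih
  subst hx
  have hgij := (cs.isResidueAlternating_mul_simple_of_isRightDescent hij hi hj).2
  have hgi := hgij.isRightDescent hij.symm (by omega)
  have hg₁ij := hgij.mul_simple_of_pos (by omega)
  have hg₁j := hg₁ij.isRightDescent hij (by omega)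
  obtain ⟨hp, hg₁ik⟩ := cs.isResidueAlternating_mul_simple_of_isRightDescent hik.symm hk hgi
  have hg₁k := hg₁ik.isRightDescent hik (by omega)
  have hg₂ij := hg₁ij.mul_simple_of_pos (by omega)
  have hg₂i := hg₂ij.isRightDescent hij.symm (by omega)
  have hg₂jk := (cs.isResidueAlternating_mul_simple_of_isRightDescent hjk.symm hg₁k hg₁j).2
  rw [M.symmetric k j] at hg₂jk
  have hg₂k := hg₂jk.isRightDescent hjk (by omega)
  have hyjk := hg₂jk.mul_simple_of_pos (by omega)
  have hyj := hyjk.isRightDescent hjk.symm (by omega)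
  obtain ⟨hp', hyik⟩ := cs.isResidueAlternating_mul_simple_of_isRightDescent hik hg₂i hg₂k
  have hyi := hyik.isRightDescent hik.symm (by omega)
  have hzjk := hyjk.mul_simple_of_pos (by omega)
  have hzk := hzjk.isRightDescent hjk (by omega)
  exact ih _ (hg₂k.trans <| hg₁j.trans <| hgi.trans hj) hyi hyj hzk rfl

theorem IsResidueAlternating.not_isRightDescent {i j k : B}
    (hij : i ≠ j) (hik : i ≠ k) (hjk : j ≠ k) (hn : 6 ≤ M i j) (hp : M i k = 2)
    (hq : 3 ≤ M j k) {x : W} {e : ℕ} (he : 4 ≤ e) (hx : cs.IsResidueAlternating j i e x) :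
    ¬ cs.IsRightDescent x k := by
  intro hk
  induction hl : cs.length x using Nat.strong_induction_on generalizing x e with | _ l ih
  subst hl
  have hi := hx.isRightDescent hij.symm (by omega)
  have hx₁ij := hx.mul_simple_of_pos (by omega)
  have hx₁j := hx₁ij.isRightDescent hij (by omega)
  have hx₁ik := (cs.isResidueAlternating_mul_simple_of_isRightDescent hik.symm hk hi).2
  rw [M.symmetric k i] at hx₁ik
  have hx₁k := hx₁ik.isRightDescent hik (by omega)
  have hx₂ij := hx₁ij.mul_simple_of_pos (by omega)
  have hx₂i := hx₂ij.isRightDescent hij.symm (by omega)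
  have hx₂jk := (cs.isResidueAlternating_mul_simple_of_isRightDescent hjk.symm hx₁k hx₁j).2
  rw [M.symmetric k j] at hx₂jk
  have hx₂k := hx₂jk.isRightDescent hjk (by omega)
  have hx₃j := (hx₂ij.mul_simple_of_pos (by omega)).isRightDescent hij (by omega)
  have hx₃ik := (cs.isResidueAlternating_mul_simple_of_isRightDescent hik.symm hx₂k hx₂i).2
  rw [M.symmetric k i] at hx₃ik
  have hx₃k := hx₃ik.isRightDescent hik (by omega)
  have hyj := (hx₂jk.mul_simple_of_pos (by omega)).isRightDescent hjk.symm (by omega)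
  have hyi := (cs.isResidueAlternating_mul_simple_of_isRightDescent hik hx₂i hx₂k).2.isRightDescent
    hik.symm (by omega)
  have hzij := (cs.isResidueAlternating_mul_simple_of_isRightDescent hij.symm hyj hyi).2
  rw [M.symmetric j i] at hzij
  have hzj := hzij.isRightDescent hij (by omega)
  have hwij := hzij.mul_simple_of_pos (by omega)
  have hwjk := (cs.isResidueAlternating_mul_simple_of_isRightDescent hjk hx₃j hx₃k).2
    |>.mul_simple_of_pos (by omega)
  rw [mul_assoc _ (cs.simple i) (cs.simple k), (cs.simple_commute_of_eq_two hp).eq,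
    ← mul_assoc _ (cs.simple k) (cs.simple i)] at hwjk
  exact ih _ (hzj.trans <| hyi.trans <| hx₂k.trans <| hx₁j.trans hi) (by omega) hwij
    (hwjk.isRightDescent hjk (by omega)) rfl

end CoxeterSystem

/-- A group generated by involutions is finite if the base coset of a finite subgroup lies in a
finite set of cosets stable under the generators. -/
theorem Subgroup.finite_closure_of_smul_mem {G : Type*} [Group G] {S : Set G} {K : Subgroup G}
    (hK : (K : Set G).Finite) {V : Set (G ⧸ K)} (hV : V.Finite) (h1 : ((1 : G) : G ⧸ K) ∈ V)
    (hS : ∀ s ∈ S, ∀ v ∈ V, s • v ∈ V) (hinv : ∀ s ∈ S, s⁻¹ = s) :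
    (Subgroup.closure S : Set G).Finite := by
  have hmem (g : G) (hg : g ∈ Subgroup.closure S) : ∀ v ∈ V, g • v ∈ V := by
    induction hg using Subgroup.closure_induction'' with
    | mem x hx => exact hS x hx
    | inv_mem x hx => rw [hinv x hx]; exact hS x hx
    | one => simp
    | mul x y _ _ hx hy => intro v hv; rw [mul_smul]; exact hx _ (hy _ hv)
  refine (hV.preimage' (f := ((↑) : G → G ⧸ K)) fun q _ ↦ ?_).subset fun g hg ↦ ?_
  · induction q using QuotientGroup.induction_on with
    | H a =>
      refine (hK.image (a * ·)).subset fun x hx ↦ ⟨a⁻¹ * x, ?_, by simp⟩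
      exact QuotientGroup.eq.mp (Set.mem_singleton_iff.mp hx).symm
  · have := hmem g hg _ h1
    rwa [MulAction.Quotient.smul_coe, smul_eq_mul, mul_one] at this

section Orbits

variable {G X : Type*} [Group G] [MulAction G X] {a b c : G} {v : X}

theorem smul_smul_smul_comm_of_mul_eq (h : c * b * c = b * c * b) (x : X) :
    c • b • c • x = b • c • b • x := by
  simpa only [mul_smul] using congrArg (· • x) h

/-- In the Coxeter group of type `B₃`, the orbit of a point fixed by the parabolic subgroup of
type `B₂` has at most six elements. -/
theorem exists_finite_smul_mem_of_braid_four (ha : a * a = 1) (hb : b * b = 1) (hc : c * c = 1)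
    (hac : a * c = c * a) (hbc : c * b * c = b * c * b) (hab : a * b * a * b = b * a * b * a)
    (hav : a • v = v) (hbv : b • v = v) :
    ∃ V : Set X, V.Finite ∧ v ∈ V ∧ ∀ g ∈ ({a, b, c} : Set G), ∀ x ∈ V, g • x ∈ V := by
  have ha' (x : X) : a • a • x = x := by rw [smul_smul, ha, one_smul]
  have hb' (x : X) : b • b • x = x := by rw [smul_smul, hb, one_smul]
  have hc' (x : X) : c • c • x = x := by rw [smul_smul, hc, one_smul]
  have hac' (x : X) : a • c • x = c • a • x := by rw [smul_smul, hac, mul_smul]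
  have hbc' (x : X) : c • b • c • x = b • c • b • x := smul_smul_smul_comm_of_mul_eq hbc x
  have hab' (x : X) : b • a • b • a • x = a • b • a • b • x := by
    simpa only [mul_smul] using (congrArg (· • x) hab).symm
  obtain ⟨v₁, h₁⟩ : ∃ y, c • v = y := ⟨_, rfl⟩
  obtain ⟨v₂, h₂⟩ : ∃ y, b • v₁ = y := ⟨_, rfl⟩
  obtain ⟨v₃, h₃⟩ : ∃ y, a • v₂ = y := ⟨_, rfl⟩
  obtain ⟨v₄, h₄⟩ : ∃ y, b • v₃ = y := ⟨_, rfl⟩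
  obtain ⟨v₅, h₅⟩ : ∃ y, c • v₄ = y := ⟨_, rfl⟩
  have e₁ : a • v₁ = v₁ := by rw [← h₁, hac', hav]
  have e₂ : c • v₂ = v₂ := by rw [← h₂, ← h₁, hbc', hbv]
  have e₃ : c • v₃ = v₃ := by rw [← h₃, ← hac', e₂]
  have e₄ : a • v₄ = v₄ := by rw [← h₄, ← h₃, ← h₂, ← hab', e₁]
  have e₅ : a • v₅ = v₅ := by rw [← h₅, hac', e₄]
  have e₆ : b • v₅ = v₅ := by rw [← h₅, ← h₄, ← hbc', e₃]
  refine ⟨{v, v₁, v₂, v₃, v₄, v₅}, Set.toFinite _, by simp, ?_⟩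
  have f₁ : c • v₁ = v := by rw [← h₁, hc']
  have f₂ : b • v₂ = v₁ := by rw [← h₂, hb']
  have f₃ : a • v₃ = v₂ := by rw [← h₃, ha']
  have f₄ : b • v₄ = v₃ := by rw [← h₄, hb']
  have f₅ : c • v₅ = v₄ := by rw [← h₅, hc']
  rintro g (rfl | rfl | rfl) x (rfl | rfl | rfl | rfl | rfl | rfl) <;> simp [*]

/-- In the Coxeter group of type `H₃`, the orbit of a point fixed by the parabolic subgroup of
type `I₂(5)` has at most twelve elements. -/
theorem exists_finite_smul_mem_of_braid_five (ha : a * a = 1) (hb : b * b = 1) (hc : c * c = 1)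
    (hac : a * c = c * a) (hbc : c * b * c = b * c * b)
    (hab : a * b * a * b * a = b * a * b * a * b) (hav : a • v = v) (hbv : b • v = v) :
    ∃ V : Set X, V.Finite ∧ v ∈ V ∧ ∀ g ∈ ({a, b, c} : Set G), ∀ x ∈ V, g • x ∈ V := by
  have ha' (x : X) : a • a • x = x := by rw [smul_smul, ha, one_smul]
  have hb' (x : X) : b • b • x = x := by rw [smul_smul, hb, one_smul]
  have hc' (x : X) : c • c • x = x := by rw [smul_smul, hc, one_smul]
  have hac' (x : X) : a • c • x = c • a • x := by rw [smul_smul, hac, mul_smul]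
  have hbc' (x : X) : c • b • c • x = b • c • b • x := smul_smul_smul_comm_of_mul_eq hbc x
  have hab' (x : X) : b • a • b • a • b • x = a • b • a • b • a • x := by
    simpa only [mul_smul] using (congrArg (· • x) hab).symm
  obtain ⟨v₁, h₁⟩ : ∃ y, c • v = y := ⟨_, rfl⟩
  obtain ⟨v₂, h₂⟩ : ∃ y, b • v₁ = y := ⟨_, rfl⟩
  obtain ⟨v₃, h₃⟩ : ∃ y, a • v₂ = y := ⟨_, rfl⟩
  obtain ⟨v₄, h₄⟩ : ∃ y, b • v₃ = y := ⟨_, rfl⟩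
  obtain ⟨v₅, h₅⟩ : ∃ y, a • v₄ = y := ⟨_, rfl⟩
  obtain ⟨v₆, h₆⟩ : ∃ y, c • v₄ = y := ⟨_, rfl⟩
  obtain ⟨v₇, h₇⟩ : ∃ y, a • v₆ = y := ⟨_, rfl⟩
  obtain ⟨v₈, h₈⟩ : ∃ y, b • v₇ = y := ⟨_, rfl⟩
  obtain ⟨v₉, h₉⟩ : ∃ y, a • v₈ = y := ⟨_, rfl⟩
  obtain ⟨v₁₀, h₁₀⟩ : ∃ y, b • v₉ = y := ⟨_, rfl⟩
  obtain ⟨v₁₁, h₁₁⟩ : ∃ y, c • v₁₀ = y := ⟨_, rfl⟩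
  have e₁ : a • v₁ = v₁ := by rw [← h₁, hac', hav]
  have e₂ : c • v₂ = v₂ := by rw [← h₂, ← h₁, hbc', hbv]
  have e₃ : c • v₃ = v₃ := by rw [← h₃, ← hac', e₂]
  have e₅ : b • v₅ = v₅ := by rw [← h₅, ← h₄, ← h₃, ← h₂, hab', e₁]
  have e₆ : b • v₆ = v₆ := by rw [← h₆, ← h₄, ← hbc', e₃]
  have e₇ : c • v₅ = v₇ := by rw [← h₅, ← hac', h₆, h₇]
  have e₈ : c • v₈ = v₈ := by rw [← h₈, ← e₇, hbc', e₅]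
  have e₉ : c • v₉ = v₉ := by rw [← h₉, ← hac', e₈]
  have e₁₀ : a • v₁₀ = v₁₀ := by rw [← h₁₀, ← h₉, ← h₈, ← h₇, ← hab', e₆]
  have e₁₁ : a • v₁₁ = v₁₁ := by rw [← h₁₁, hac', e₁₀]
  have e₁₂ : b • v₁₁ = v₁₁ := by rw [← h₁₁, ← h₁₀, ← hbc', e₉]
  refine ⟨{v, v₁, v₂, v₃, v₄, v₅, v₆, v₇, v₈, v₉, v₁₀, v₁₁}, Set.toFinite _, by simp, ?_⟩
  have f₁ : c • v₁ = v := by rw [← h₁, hc']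
  have f₂ : b • v₂ = v₁ := by rw [← h₂, hb']
  have f₃ : a • v₃ = v₂ := by rw [← h₃, ha']
  have f₄ : b • v₄ = v₃ := by rw [← h₄, hb']
  have f₅ : a • v₅ = v₄ := by rw [← h₅, ha']
  have f₆ : c • v₆ = v₄ := by rw [← h₆, hc']
  have f₇ : a • v₇ = v₆ := by rw [← h₇, ha']
  have f₇' : c • v₇ = v₅ := by rw [← e₇, hc']
  have f₈ : b • v₈ = v₇ := by rw [← h₈, hb']
  have f₉ : a • v₉ = v₈ := by rw [← h₉, ha']
  have f₁₀ : b • v₁₀ = v₉ := by rw [← h₁₀, hb']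
  have f₁₁ : c • v₁₁ = v₁₀ := by rw [← h₁₁, hc']
  rintro g (rfl | rfl | rfl) x
    (rfl | rfl | rfl | rfl | rfl | rfl | rfl | rfl | rfl | rfl | rfl | rfl) <;> simp [*]

end Orbits

namespace CoxeterSystem

variable {B W : Type*} [Group W] {M : CoxeterMatrix B} (cs : CoxeterSystem M W)

theorem finite_closure_pair {i j : B} (h : M i j ≠ 0) :
    (Subgroup.closure {cs.simple i, cs.simple j} : Set W).Finite := by
  refine (((Finset.range (M i j + 1)).finite_toSet.image fun k ↦
    cs.wordProd (alternatingWord i j k)).union ((Finset.range (M i j + 1)).finite_toSet.image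
    fun k ↦ cs.wordProd (alternatingWord j i k))).subset fun d hd ↦ ?_
  obtain ⟨k, hk, rfl | rfl⟩ := cs.exists_alternatingWord_of_mem_closure hd
  · exact .inl ⟨k, by simp; omega, rfl⟩
  · exact .inr ⟨k, by simp; omega, rfl⟩

theorem finite_closure_triple {i j k : B} (hij : M i j = 4 ∨ M i j = 5) (hik : M i k = 2)
    (hjk : M j k = 3) :
    (Subgroup.closure {cs.simple i, cs.simple j, cs.simple k} : Set W).Finite := by
  have hfix (l : B) (hl : l = i ∨ l = j) : cs.simple l •
      ((1 : W) : W ⧸ Subgroup.closure {cs.simple i, cs.simple j}) = ((1 : W) : W ⧸ _) := by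
    rw [MulAction.Quotient.smul_coe, smul_eq_mul, mul_one, QuotientGroup.eq, mul_one]
    exact inv_mem (Subgroup.subset_closure (by rcases hl with rfl | rfl <;> simp))
  have hbraid := cs.wordProd_braidWord_eq j k
  have hbraid' := cs.wordProd_braidWord_eq i j
  have h : ∃ V : Set (W ⧸ Subgroup.closure {cs.simple i, cs.simple j}), V.Finite ∧
      ((1 : W) : W ⧸ _) ∈ V ∧
      ∀ g ∈ ({cs.simple i, cs.simple j, cs.simple k} : Set W), ∀ x ∈ V, g • x ∈ V := by
    rw [braidWord, braidWord, M.symmetric k j, hjk] at hbraid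
    rw [braidWord, braidWord, M.symmetric j i] at hbraid'
    rcases hij with h4 | h5
    · refine exists_finite_smul_mem_of_braid_four (cs.simple_mul_simple_self i)
        (cs.simple_mul_simple_self j) (cs.simple_mul_simple_self k)
        (cs.simple_commute_of_eq_two hik).eq ?_ ?_ (hfix i (.inl rfl)) (hfix j (.inr rfl))
      · simpa [alternatingWord, wordProd_cons, mul_assoc] using hbraid
      · rw [h4] at hbraid'
        simpa [alternatingWord, wordProd_cons, mul_assoc] using hbraid'
    · refine exists_finite_smul_mem_of_braid_five (cs.simple_mul_simple_self i)
        (cs.simple_mul_simple_self j) (cs.simple_mul_simple_self k)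
        (cs.simple_commute_of_eq_two hik).eq ?_ ?_ (hfix i (.inl rfl)) (hfix j (.inr rfl))
      · simpa [alternatingWord, wordProd_cons, mul_assoc] using hbraid
      · rw [h5] at hbraid'
        simpa [alternatingWord, wordProd_cons, mul_assoc] using hbraid'.symm
  obtain ⟨V, hV, h1, hS⟩ := h
  refine Subgroup.finite_closure_of_smul_mem (cs.finite_closure_pair (by omega)) hV h1 hS ?_
  rintro s (rfl | rfl | rfl) <;> exact cs.inv_simple _

theorem le_three_of_isRightDescent_mul_simple {i j k : B} (hij : i ≠ j) (hik : i ≠ k)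
    (hjk : j ≠ k)
    (hinf : ¬ (Subgroup.closure {cs.simple i, cs.simple j, cs.simple k} : Set W).Finite)
    {f : W} (hi : cs.IsRightDescent f i) (hj : cs.IsRightDescent f j)
    (hk : ¬ cs.IsRightDescent f k) (hjk' : cs.IsRightDescent (f * cs.simple j) k) :
    M i j ≤ 3 ∧ (M i j = 3 → M i k = 2) := by
  rcases lt_or_ge (M i j) 3 with hlt | hn
  · exact ⟨by omega, by omega⟩
  have hgij := (cs.isResidueAlternating_mul_simple_of_isRightDescent hij hi hj).2
  have hgi := hgij.isRightDescent hij.symm (by omega)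
  have hg₁j := (hgij.mul_simple_of_pos (by omega)).isRightDescent hij (by omega)
  obtain ⟨hp, hg₁ik⟩ := cs.isResidueAlternating_mul_simple_of_isRightDescent hik.symm hjk' hgi
  rw [M.symmetric k i] at hp hg₁ik
  have hg₁k := hg₁ik.isRightDescent hik (by omega)
  have hq := (cs.isResidueAlternating_mul_simple_of_isRightDescent hjk hg₁j hg₁k).1
  have hq2 : M j k ≠ 2 := by
    intro h2
    rw [isRightDescent_iff] at hj hjk'
    rw [not_isRightDescent_iff] at hk
    have hle := cs.length_mul_simple (f * cs.simple k) j
    rw [mul_assoc, ← (cs.simple_commute_of_eq_two h2).eq, ← mul_assoc] at hle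
    omega
  have hp2 : M i k = 2 := by
    by_contra hne
    exact cs.not_isRightDescent_mul_simple_of_three_le hij hik hjk hn (by omega) (by omega) hi hj
      hjk'
  refine ⟨?_, fun _ ↦ hp2⟩
  by_contra hn3
  have hq3 : M j k = 3 := by
    by_contra hne
    exact cs.not_isRightDescent_mul_simple_of_four_le hij hik hjk (by omega) (by omega) hi hj hjk'
  rcases lt_or_ge (M i j) 6 with hlt | hn6
  · exact hinf (cs.finite_closure_triple (by omega) hp2 hq3)
  · exact hgij.not_isRightDescent hij hik hjk hn6 hp2 (by omega) (by omega) hjk'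

theorem eq_wordProd_alternatingWord_of_le_length {i j : B} (hij : i ≠ j) (h0 : M i j ≠ 0) {d : W}
    (hd : d ∈ Subgroup.closure {cs.simple i, cs.simple j}) (hl : M i j ≤ cs.length d) :
    d = cs.wordProd (alternatingWord i j (M i j)) := by
  have hbraid := cs.wordProd_braidWord_eq j i
  rw [braidWord, braidWord, M.symmetric j i] at hbraid
  obtain ⟨k, hk, rfl | rfl⟩ := cs.exists_alternatingWord_of_mem_closure hd
  · rw [cs.length_alternatingWord_of_le hij (by omega)] at hl
    rw [show k = M i j by omega]
  · rw [cs.length_alternatingWord_of_le hij.symm (by rw [M.symmetric]; omega)] at hl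
    rw [show k = M i j by omega, hbraid]

end CoxeterSystem

namespace CoxeterPaper

open CoxeterSystem

theorem wg_eq_wordProd_alternatingWord {B W : Type} [Group W] {M : CoxeterMatrix B}
    (cs : CoxeterSystem M W) {f : W} {i j : B} (hij : i ≠ j) (h0 : M i j ≠ 0)
    (hTf : descentSet cs f = {i, j}) :
    wg cs f = cs.wordProd (alternatingWord i j (M i j)) := by
  have hD : descSubgroup cs f = Subgroup.closure {cs.simple i, cs.simple j} := by
    rw [descSubgroup, hTf, Set.image_pair]
  have hw := cs.wordProd_alternatingWord_mem_closure i j (M i j)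
  have hwl := cs.length_alternatingWord_of_le hij (le_refl (M i j))
  have hex : ∃ w₀ ∈ descSubgroup cs f, ∀ u ∈ descSubgroup cs f, cs.length u ≤ cs.length w₀ := by
    rw [hD]
    refine ⟨_, hw, fun u hu ↦ ?_⟩
    by_contra! h
    rw [hwl] at h
    rw [cs.eq_wordProd_alternatingWord_of_le_length hij h0 hu h.le] at h
    omega
  rw [wg, dif_pos hex]
  obtain ⟨hmem, hmax⟩ := hex.choose_spec
  exact cs.eq_wordProd_alternatingWord_of_le_length hij h0 (hD ▸ hmem) (hwl ▸ hmax _ (hD ▸ hw))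

attribute [local instance] Classical.propDecidable

variable {B : Type} [DecidableEq B] [Fintype B]
variable {W : Type} [Group W] {M : CoxeterMatrix B}

/-- **Corollary (v).** If `m = m_st - 1`, then `m_st ≤ 3`, and if moreover `m_st = 3` then
`m_sr = 2`. -/
theorem corollary_step1_v
    (cs : CoxeterSystem M W) (h2 : TwoDimensional cs)
    (f : W) (i j : B) (hij : i ≠ j) (hTf : descentSet cs f = {i, j})
    (g : W) (hgR : f⁻¹ * g ∈ Subgroup.closure {cs.simple i, cs.simple j})
    (k : B) (hki : k ≠ i) (hkj : k ≠ j) (hTg : descentSet cs g = {i, k})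
    (hm : cs.length ((PiMap cs f)⁻¹ * g) = M.M i j - 1) :
    M.M i j ≤ 3 ∧ (M.M i j = 3 → M.M i k = 2) := by
  have hdesc (x : W) (l : B) : cs.IsRightDescent x l ↔ l ∈ descentSet cs x := Iff.rfl
  have hfi : cs.IsRightDescent f i := by rw [hdesc, hTf]; simp
  have hfj : cs.IsRightDescent f j := by rw [hdesc, hTf]; simp
  have hfk : ¬ cs.IsRightDescent f k := by rw [hdesc, hTf]; simp [hki, hkj]
  have hgk : cs.IsRightDescent g k := by rw [hdesc, hTg]; simp
  have hgj : ¬ cs.IsRightDescent g j := by rw [hdesc, hTg]; simp [hij.symm, hkj.symm]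
  obtain ⟨h0, -, y, hy, hf⟩ := cs.isResidueAlternating_of_isRightDescent hij hfi hfj
  have hw := cs.wordProd_alternatingWord_mem_closure i j (M i j)
  have hPi : PiMap cs f = y := by
    have hinv : (cs.wordProd (alternatingWord i j (M i j)))⁻¹ =
        cs.wordProd (alternatingWord i j (M i j)) :=
      cs.eq_wordProd_alternatingWord_of_le_length hij h0 (inv_mem hw) <| by
        rw [length_inv, cs.length_alternatingWord_of_le hij le_rfl]
    rw [PiMap, wg_eq_wordProd_alternatingWord cs hij h0 hTf, ← hinv]
    nth_rw 1 [hf]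
    rw [mul_inv_cancel_right]
  rw [hPi] at hm
  have hd : y⁻¹ * g ∈ Subgroup.closure {cs.simple i, cs.simple j} := by
    have hyf : y⁻¹ * f ∈ Subgroup.closure {cs.simple i, cs.simple j} := by
      rw [hf, inv_mul_cancel_left]
      exact hw
    simpa [mul_assoc] using mul_mem hyf hgR
  have hdj : ¬ cs.IsRightDescent (y⁻¹ * g) j := by
    rw [← hy.isRightDescent_mul_iff hd (.inr rfl), mul_inv_cancel_left]
    exact hgj
  have hj : cs.simple j ∈ Subgroup.closure {cs.simple i, cs.simple j} :=
    Subgroup.subset_closure (by simp)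
  have hgf : g = f * cs.simple j := by
    have h := cs.eq_wordProd_alternatingWord_of_le_length hij h0 (mul_mem hd hj) <| by
      rw [not_isRightDescent_iff] at hdj
      change _ = M i j - 1 at hm
      omega
    rw [hf, ← h, mul_assoc, mul_assoc, simple_mul_simple_self, mul_one, mul_inv_cancel_left]
  refine cs.le_three_of_isRightDescent_mul_simple hij hki.symm hkj.symm ?_ hfi hfj hfk (hgf ▸ hgk)
  have := h2 i j k hij hki.symm hkj.symm
  exact fun hfin ↦ Set.not_infinite.mpr hfin (Set.infinite_coe_iff.mp this)

end CoxeterPaper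
end
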